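/- For every pair of integers n, t with 3 ≤ t ≤ n, there exists a connected graph G on n vertices with reg(J_G) = t. In particular, the graph G = P_t * K_{n−t}^c (the join of a path on t vertices with n − t isolated vertices) has this property, using that reg(J_{P_t}) = t and reg(J_{G1*G2}) = max{reg(J_{G1}), reg(J_{G2}), 3} when G1 * G2 is not complete. -/

import Mathlib

open MvPolynomial

noncomputable section

variable {K : Type} [Field K] {σ : Type}

/-- `p` is homogeneous of degree `z : ℤ` (the zero polynomial is homogeneous of any degree). -/
def IsHomZ (p : MvPolynomial σ K) (z : ℤ) : Prop :=
  ∀ d ∈ p.support, (d.sum fun _ e => (e : ℤ)) = z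

/-- Homogeneous elements of degree `z` of the polynomial ring, as an additive subgroup. -/
def polyGr (K : Type) [Field K] (σ : Type) (z : ℤ) :
    AddSubgroup (MvPolynomial σ K) where
  carrier := {p | IsHomZ p z}
  zero_mem' := by intro d hd; simp at hd
  add_mem' := by
    classical
    intro p q hp hq d hd
    rcases Finset.mem_union.mp (MvPolynomial.support_add hd) with h | h
    · exact hp d h
    · exact hq d h
  neg_mem' := by
    intro p hp d hd
    exact hp d (by simpa using hd)

/-- An element of a graded free module `B →₀ S`, with generator `b` in degree `dg b`,
is homogeneous of degree `z`. -/
def FinsuppHomog {B : Type} (dg : B → ℤ) (x : B →₀ MvPolynomial σ K) (z : ℤ) : Prop :=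
  ∀ b, IsHomZ (x b) (z - dg b)

/-- A graded free resolution of a module `M` over the polynomial ring,
with degree-`0` (i.e. graded) differentials; the grading of `M` is recorded by
the family of additive subgroups `gr`. -/
structure GradedFreeResolution {M : Type} [AddCommGroup M]
    [Module (MvPolynomial σ K) M] (gr : ℤ → AddSubgroup M) where
  B : ℕ → Type
  dg : ∀ i, B i → ℤ
  φ : ∀ i, (B (i + 1) →₀ MvPolynomial σ K) →ₗ[MvPolynomial σ K]
        (B i →₀ MvPolynomial σ K)
  π : (B 0 →₀ MvPolynomial σ K) →ₗ[MvPolynomial σ K] M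
  φ_graded : ∀ i b, FinsuppHomog (dg i) (φ i (Finsupp.single b 1)) (dg (i + 1) b)
  π_graded : ∀ b, π (Finsupp.single b 1) ∈ gr (dg 0 b)
  π_surj : Function.Surjective π
  exact0 : Function.Exact (φ 0) π
  exact : ∀ i, Function.Exact (φ (i + 1)) (φ i)

/-- Castelnuovo–Mumford regularity of a graded module, defined as the infimum over
all graded free resolutions of the largest twist: `reg M = min_F max {deg b - i}`;
the minimal free resolution realizes this infimum. -/
def moduleReg (K : Type) [Field K] (σ : Type) {M : Type} [AddCommGroup M]
    [Module (MvPolynomial σ K) M] (gr : ℤ → AddSubgroup M) : ℤ :=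
  sInf {r : ℤ | ∃ F : GradedFreeResolution (K := K) (σ := σ) gr,
    ∀ i b, F.dg i b ≤ r + i}

/-- Grading on (the underlying module of) a homogeneous ideal. -/
def idealGr (I : Ideal (MvPolynomial σ K)) (z : ℤ) : AddSubgroup I where
  carrier := {x | IsHomZ (x : MvPolynomial σ K) z}
  zero_mem' := by intro d hd; simp at hd
  add_mem' := by
    classical
    intro p q hp hq d hd
    rcases Finset.mem_union.mp (MvPolynomial.support_add hd) with h | h
    · exact hp d h
    · exact hq d h
  neg_mem' := by
    intro p hp d hd
    exact hp d (by simpa using hd)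

/-- Grading on the quotient `S/I` of the polynomial ring by a homogeneous ideal. -/
def quotGr (I : Ideal (MvPolynomial σ K)) (z : ℤ) :
    AddSubgroup (MvPolynomial σ K ⧸ I) :=
  (polyGr K σ z).map (Ideal.Quotient.mk I).toAddMonoidHom

/-- The Castelnuovo–Mumford regularity `reg I` of a homogeneous ideal. -/
def idealReg (I : Ideal (MvPolynomial σ K)) : ℤ :=
  moduleReg K σ (idealGr I)

/-- The Castelnuovo–Mumford regularity `reg S/I`. -/
def quotReg (I : Ideal (MvPolynomial σ K)) : ℤ :=
  moduleReg K σ (quotGr I)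

/-- The binomial edge ideal of a graph `G` on `[n]`, in
`S = K[x_1, …, x_n, y_1, …, y_n]` where `x_i = X (inl i)` and `y_i = X (inr i)`. -/
def beIdeal (K : Type) [Field K] {n : ℕ} (G : SimpleGraph (Fin n)) :
    Ideal (MvPolynomial (Fin n ⊕ Fin n) K) :=
  Ideal.span {f | ∃ i j, G.Adj i j ∧
    f = X (Sum.inl i) * X (Sum.inr j) - X (Sum.inl j) * X (Sum.inr i)}

/-- The initial ideal of `I` with respect to a monomial order `m`: the ideal generated
by the leading monomials of the nonzero elements of `I`. -/
def initialIdeal (m : MonomialOrder σ) (I : Ideal (MvPolynomial σ K)) :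
    Ideal (MvPolynomial σ K) :=
  Ideal.span {g | ∃ f ∈ I, ∃ d ∈ f.support,
    (∀ d' ∈ f.support, m.toSyn d' ≤ m.toSyn d) ∧ g = monomial d (1 : K)}

/-- A finite injective resolution `0 → M → I⁰ → I¹ → ⋯ → Iⁿ → 0`. -/
structure FiniteInjectiveResolution (R : Type) [CommRing R] (M : Type) [AddCommGroup M]
    [Module R M] where
  n : ℕ
  I : ℕ → Type
  acg : ∀ i, AddCommGroup (I i)
  mod : ∀ i, @Module R (I i) _ (acg i).toAddCommMonoid
  inj : ∀ i, @Module.Injective R _ (I i) (acg i) (mod i)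
  ι : @LinearMap R R _ _ (RingHom.id R) M (I 0) _ (acg 0).toAddCommMonoid _ (mod 0)
  d : ∀ i, @LinearMap R R _ _ (RingHom.id R) (I i) (I (i + 1))
        (acg i).toAddCommMonoid (acg (i + 1)).toAddCommMonoid (mod i) (mod (i + 1))
  ι_inj : Function.Injective ι
  ex0 : Function.Exact ι (d 0)
  ex : ∀ i, Function.Exact (d i) (d (i + 1))
  bounded : ∀ i > n, ∀ x : I i, x = 0

/-- A (finite-dimensional) Noetherian ring is Gorenstein iff it has finite injective
dimension over itself. -/
def IsGorensteinRing (R : Type) [CommRing R] : Prop :=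
  IsNoetherianRing R ∧ Nonempty (FiniteInjectiveResolution R R)

end

/-- The join `P_t * K_{n-t}^c`: on `Fin n`, the first `t` vertices form a path and the
remaining `n - t` vertices are pairwise nonadjacent, with all edges between the two parts. -/

def pathJoinGraph (n t : ℕ) : SimpleGraph (Fin n) :=
  SimpleGraph.fromRel (fun a b =>
    (a.val + 1 = b.val ∧ b.val < t) ∨ (a.val < t ∧ t ≤ b.val))


noncomputable section Reg16

/-- total degree of an exponent as an integer -/
def dgZ {σ : Type} (d : σ →₀ ℕ) : ℤ := d.sum fun _ e => (e : ℤ)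

lemma dgZ_add {σ : Type} (d e : σ →₀ ℕ) : dgZ (d + e) = dgZ d + dgZ e := by
  classical
  unfold dgZ
  rw [Finsupp.sum_add_index'] <;> simp

lemma dgZ_zero {σ : Type} : dgZ (0 : σ →₀ ℕ) = 0 := by simp [dgZ]

lemma dgZ_single {σ : Type} (i : σ) (k : ℕ) : dgZ (Finsupp.single i k) = k := by
  simp [dgZ]

lemma dgZ_nonneg {σ : Type} (d : σ →₀ ℕ) : 0 ≤ dgZ d := by
  unfold dgZ Finsupp.sum
  exact Finset.sum_nonneg (fun _ _ => by positivity)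

lemma dgZ_degree {σ : Type} (d : σ →₀ ℕ) : dgZ d = (d.degree : ℤ) := by
  simp only [dgZ, Finsupp.degree, Finsupp.sum]
  exact (Nat.cast_sum _ _).symm

open Classical in
/-- homogeneous component of degree `z` -/
def hc {K : Type} [Field K] {σ : Type} (z : ℤ) : MvPolynomial σ K →+ MvPolynomial σ K :=
  if 0 ≤ z then (homogeneousComponent z.toNat : MvPolynomial σ K →ₗ[K] MvPolynomial σ K).toAddMonoidHom
  else 0

section hcs
variable {K : Type} [Field K] {σ : Type}

open Classical in
lemma coeff_hc (z : ℤ) (p : MvPolynomial σ K) (d : σ →₀ ℕ) :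
    coeff d (hc z p) = if dgZ d = z then coeff d p else 0 := by
  unfold hc
  by_cases hz : 0 ≤ z
  · rw [if_pos hz]
    simp only [LinearMap.toAddMonoidHom_coe, coeff_homogeneousComponent, dgZ_degree]
    congr 1
    apply propext
    omega
  · rw [if_neg hz, if_neg]
    · simp
    · have := dgZ_nonneg d
      omega

lemma isHomZ_iff (p : MvPolynomial σ K) (z : ℤ) : IsHomZ p z ↔ hc z p = p := by
  classical
  constructor
  · intro h
    ext d
    rw [coeff_hc]
    split_ifs with hd
    · rfl
    · by_contra hne
      exact hd (h d (mem_support_iff.2 (Ne.symm hne)))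
  · intro h d hd
    rw [mem_support_iff, ← h, coeff_hc] at hd
    by_contra hne
    exact hd (if_neg hne)

lemma hc_idem (z : ℤ) (p : MvPolynomial σ K) : hc z (hc z p) = hc z p := by
  classical
  ext d
  rw [coeff_hc, coeff_hc]
  split_ifs <;> rfl

lemma hc_orth (z w : ℤ) (p : MvPolynomial σ K) (h : z ≠ w) : hc z (hc w p) = 0 := by
  classical
  ext d
  rw [coeff_hc, coeff_hc]
  split_ifs with h1 h2
  · omega
  · rfl
  · rfl

lemma hc_monomial_mul (z : ℤ) (d : σ →₀ ℕ) (a : K) (p : MvPolynomial σ K) :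
    hc z (monomial d a * p) = monomial d a * hc (z - dgZ d) p := by
  classical
  ext e
  rw [coeff_hc, coeff_monomial_mul', coeff_monomial_mul']
  by_cases h : d ≤ e
  · rw [if_pos h, if_pos h, coeff_hc]
    obtain ⟨f, rfl⟩ := exists_add_of_le h
    rw [add_tsub_cancel_left, dgZ_add]
    by_cases h2 : dgZ d + dgZ f = z
    · rw [if_pos h2, if_pos (by omega)]
    · rw [if_neg h2, if_neg (by omega), mul_zero]
  · simp [h]

lemma hc_monomial (z : ℤ) (d : σ →₀ ℕ) (a : K) [Decidable (dgZ d = z)] :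
    hc z (monomial d a) = if dgZ d = z then monomial d a else 0 := by
  classical
  ext e
  rw [coeff_hc]
  by_cases h : d = e
  · subst h; split_ifs <;> simp
  · split_ifs <;> simp [coeff_monomial, h]

end hcs

/-- graded modules given by component maps -/
structure GM (K : Type) [Field K] (σ : Type) : Type 1 where
  M : Type
  [g : AddCommGroup M]
  [m : Module (MvPolynomial σ K) M]
  c : ℤ → M →+ M
  idem : ∀ z x, c z (c z x) = c z x
  orth : ∀ z w x, z ≠ w → c z (c w x) = 0
  smul : ∀ z d a x, c z ((monomial d a : MvPolynomial σ K) • x)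
    = (monomial d a : MvPolynomial σ K) • c (z - dgZ d) x

attribute [instance] GM.g GM.m

section fw
variable {K : Type} [Field K] {σ : Type}

lemma GM.smulH (A : GM K σ) (z w : ℤ) (s : MvPolynomial σ K) (hs : IsHomZ s w) (x : A.M) :
    A.c z (s • x) = s • A.c (z - w) x := by
  have h : s = ∑ d ∈ s.support, monomial d (coeff d s) := (support_sum_monomial_coeff s).symm
  rw [h, Finset.sum_smul, Finset.sum_smul, map_sum]
  refine Finset.sum_congr rfl fun d hd => ?_
  rw [A.smul]
  have := hs d hd
  rw [show dgZ d = w from this]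

/-- graded linear maps -/
def Gr {A B : GM K σ} (f : A.M →ₗ[MvPolynomial σ K] B.M) : Prop :=
  ∀ z x, f (A.c z x) = B.c z (f x)

def SES (A B C : GM K σ) : Prop :=
  ∃ (i : A.M →ₗ[MvPolynomial σ K] B.M) (p : B.M →ₗ[MvPolynomial σ K] C.M),
    Gr i ∧ Gr p ∧ Function.Injective i ∧ Function.Surjective p ∧ Function.Exact i p

/-- components on a free module -/
def frc {B : Type} (dg : B → ℤ) (z : ℤ) :
    (B →₀ MvPolynomial σ K) →+ (B →₀ MvPolynomial σ K) :=
  Finsupp.liftAddHom (fun b => (Finsupp.singleAddHom b).comp (hc (z - dg b)))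

lemma frc_single {B : Type} (dg : B → ℤ) (z : ℤ) (b : B) (s : MvPolynomial σ K) :
    frc dg z (Finsupp.single b s) = Finsupp.single b (hc (z - dg b) s) := by
  simp [frc]

lemma frc_apply {B : Type} (dg : B → ℤ) (z : ℤ) (x : B →₀ MvPolynomial σ K) (b : B) :
    frc dg z x b = hc (z - dg b) (x b) := by
  classical
  induction x using Finsupp.induction_linear with
  | zero => simp
  | add f g hf hg => simp [hf, hg]
  | single b' s =>
    rw [frc_single]
    by_cases h : b' = b
    · subst h; simp
    · simp [h]

/-- graded free module -/
@[reducible] def Fr (K : Type) [Field K] (σ : Type) (B : Type) (dg : B → ℤ) : GM K σ where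
  M := B →₀ MvPolynomial σ K
  c z := frc dg z
  idem := by
    intro z x
    ext1 b
    simp [frc_apply, hc_idem]
  orth := by
    intro z w x h
    ext1 b
    simp only [frc_apply, Finsupp.coe_zero, Pi.zero_apply]
    exact hc_orth _ _ _ (by omega)
  smul := by
    intro z d a x
    ext1 b
    simp only [frc_apply, Finsupp.smul_apply, smul_eq_mul, hc_monomial_mul]
    congr 3
    ring

lemma hom_iff_Fr {B : Type} (dg : B → ℤ) (z : ℤ) (x : B →₀ MvPolynomial σ K) :
    FinsuppHomog dg x z ↔ frc dg z x = x := by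
  constructor
  · intro h
    refine Finsupp.ext fun b => ?_
    rw [frc_apply, (isHomZ_iff _ _).1 (h b)]
  · intro h b
    rw [isHomZ_iff, ← frc_apply, h]

lemma GM.smul_gen (A : GM K σ) (w z : ℤ) (s : MvPolynomial σ K) (x : A.M) (hx : A.c w x = x)
    (ho : ∀ u, u ≠ w → A.c u x = 0) : A.c z (s • x) = hc (z - w) s • x := by
  classical
  induction s using MvPolynomial.induction_on' with
  | add p q hp hq => simp only [add_smul, map_add, hp, hq]
  | monomial d a =>
    rw [A.smul, hc_monomial]
    by_cases h : dgZ d = z - w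
    · rw [if_pos h, show z - dgZ d = w by omega, hx]
    · rw [if_neg h, ho _ (by omega)]; simp

/-- a map out of a free module is graded if generators have the right degree -/
lemma Gr_of_gen {B : Type} {dg : B → ℤ} {A : GM K σ}
    (f : (B →₀ MvPolynomial σ K) →ₗ[MvPolynomial σ K] A.M)
    (h : ∀ b, A.c (dg b) (f (Finsupp.single b 1)) = f (Finsupp.single b 1)) :
    Gr (A := Fr K σ B dg) f := by
  intro z x
  change f (frc dg z x) = _
  induction x using Finsupp.induction_linear with
  | zero => simp
  | add f g hf hg => simp only [map_add, hf, hg]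
  | single b s =>
    have e : ∀ s : MvPolynomial σ K, f (Finsupp.single b s) = s • f (Finsupp.single b 1) := by
      intro s
      rw [← map_smul]; simp
    rw [frc_single, e, e s, A.smul_gen (dg b) z s _ (h b)]
    intro u hu
    rw [← h b, A.orth _ _ _ hu]

lemma gen_of_Gr {B : Type} {dg : B → ℤ} {A : GM K σ}
    (f : (B →₀ MvPolynomial σ K) →ₗ[MvPolynomial σ K] A.M) (h : Gr (A := Fr K σ B dg) f) (b : B) :
    A.c (dg b) (f (Finsupp.single b 1)) = f (Finsupp.single b 1) := by
  classical
  rw [← h]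
  change f (frc dg _ _) = _
  rw [frc_single, sub_self, (isHomZ_iff _ _).1]
  intro d hd
  rw [MvPolynomial.mem_support_iff, MvPolynomial.coeff_one] at hd
  have : d = 0 := by
    by_contra hne
    exact hd (if_neg (Ne.symm hne))
  simp [this]

/-- graded submodule -/
@[reducible] def GM.sub (A : GM K σ) (N : Submodule (MvPolynomial σ K) A.M)
    (h : ∀ z, ∀ x ∈ N, A.c z x ∈ N) : GM K σ where
  M := N
  c z := ((A.c z).comp N.subtype.toAddMonoidHom).codRestrict N (fun x => h z x x.2)
  idem := by
    intro z x
    exact Subtype.ext (A.idem z x)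
  orth := by
    intro z w x hh
    exact Subtype.ext (A.orth z w x hh)
  smul := by
    intro z d a x
    exact Subtype.ext (A.smul z d a x)

/-- graded quotient -/
@[reducible] def GM.quot (A : GM K σ) (N : Submodule (MvPolynomial σ K) A.M)
    (h : ∀ z, ∀ x ∈ N, A.c z x ∈ N) : GM K σ where
  M := A.M ⧸ N
  c z := (QuotientAddGroup.map N.toAddSubgroup N.toAddSubgroup (A.c z) (fun x hx => h z x hx) :)
  idem := by
    intro z x
    obtain ⟨x, rfl⟩ := Submodule.Quotient.mk_surjective _ x
    exact congrArg (Submodule.Quotient.mk) (A.idem z x)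
  orth := by
    intro z w x hh
    obtain ⟨x, rfl⟩ := Submodule.Quotient.mk_surjective _ x
    exact congrArg (Submodule.Quotient.mk) (A.orth z w x hh)
  smul := by
    intro z d a x
    obtain ⟨x, rfl⟩ := Submodule.Quotient.mk_surjective _ x
    exact congrArg (Submodule.Quotient.mk) (A.smul z d a x)

lemma GM.quot_c_mk (A : GM K σ) (N : Submodule (MvPolynomial σ K) A.M)
    (h : ∀ z, ∀ x ∈ N, A.c z x ∈ N) (z : ℤ) (x : A.M) :
    (A.quot N h).c z (Submodule.Quotient.mk x) = Submodule.Quotient.mk (A.c z x) := rfl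

/-- direct sum -/
@[reducible] def GM.prod (A B : GM K σ) : GM K σ where
  M := A.M × B.M
  c z := (A.c z).prodMap (B.c z)
  idem := by
    intro z x
    exact Prod.ext (A.idem z _) (B.idem z _)
  orth := by
    intro z w x h
    exact Prod.ext (A.orth z w _ h) (B.orth z w _ h)
  smul := by
    intro z d a x
    exact Prod.ext (A.smul z d a _) (B.smul z d a _)

/-- one step of a free resolution -/
def Stp (r : ℤ) (A N : GM K σ) : Prop :=
  ∃ (B : Type) (dg : B → ℤ), (∀ b, dg b ≤ r) ∧ SES N (Fr K σ B dg) A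

/-- existence of a resolution with bounds, coinductively -/
def Rg (r : ℤ) (A : GM K σ) : Prop :=
  ∃ P : ℤ → GM K σ → Prop, P r A ∧ ∀ s N, P s N → ∃ N', Stp s N N' ∧ P (s + 1) N'

lemma Rg.step {r : ℤ} {A : GM K σ} (h : Rg r A) : ∃ N, Stp r A N ∧ Rg (r + 1) N := by
  obtain ⟨P, hA, hP⟩ := h
  obtain ⟨N, hN, hN'⟩ := hP _ _ hA
  exact ⟨N, hN, P, hN', hP⟩

lemma Rg.of_step {r : ℤ} {A N : GM K σ} (h : Stp r A N) (hN : Rg (r + 1) N) : Rg r A := by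
  refine ⟨fun s M => Rg s M ∨ ∃ N, Stp s M N ∧ Rg (s + 1) N, Or.inr ⟨N, h, hN⟩, ?_⟩
  rintro s M (hs | ⟨N, h1, h2⟩)
  · obtain ⟨N, h1, h2⟩ := hs.step
    exact ⟨N, h1, Or.inl h2⟩
  · exact ⟨N, h1, Or.inl h2⟩

lemma Rg.mono {r s : ℤ} {A : GM K σ} (h : Rg r A) (hrs : r ≤ s) : Rg s A := by
  refine ⟨fun s M => ∃ r ≤ s, Rg r M, ⟨r, hrs, h⟩, ?_⟩
  rintro s M ⟨r, hr, h⟩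
  obtain ⟨N, ⟨B, dg, hb, hS⟩, h2⟩ := h.step
  exact ⟨N, ⟨B, dg, fun b => (hb b).trans hr, hS⟩, r + 1, by omega, h2⟩

/-- kernel of a graded map -/
@[reducible] def GM.ker {A B : GM K σ} (f : A.M →ₗ[MvPolynomial σ K] B.M) (hf : Gr f) : GM K σ :=
  A.sub (LinearMap.ker f) (by
    intro z x hx
    rw [LinearMap.mem_ker] at *
    rw [hf, hx, map_zero])

lemma SES_ker {A B : GM K σ} (f : A.M →ₗ[MvPolynomial σ K] B.M) (hf : Gr f)
    (hs : Function.Surjective f) : SES (GM.ker f hf) A B := by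
  refine ⟨(LinearMap.ker f).subtype, f, fun z x => rfl, hf, Subtype.val_injective, hs, ?_⟩
  intro x
  constructor
  · intro h
    exact ⟨⟨x, h⟩, rfl⟩
  · rintro ⟨y, rfl⟩
    exact y.2

/-- isomorphism up to shift -/
lemma Rg.shift {r k : ℤ} {A X : GM K σ} (e : X.M ≃ₗ[MvPolynomial σ K] A.M)
    (he : ∀ z x, e (X.c z x) = A.c (z - k) (e x)) (h : Rg r A) : Rg (r + k) X := by
  refine ⟨fun s X => ∃ A : GM K σ, Rg (s - k) A ∧ ∃ e : X.M ≃ₗ[MvPolynomial σ K] A.M,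
    ∀ z x, e (X.c z x) = A.c (z - k) (e x), ⟨A, by simpa using h, e, he⟩, ?_⟩
  clear h he e
  rintro s X ⟨A, hA, e, he⟩
  obtain ⟨N, ⟨B, dg, hb, i, p, hi, hp, ii, ps, ex⟩, hN⟩ := hA.step
  let N' : GM K σ :=
    { M := N.M
      c := fun z => N.c (z - k)
      idem := fun z x => N.idem _ _
      orth := fun z w x h => N.orth _ _ _ (by omega)
      smul := fun z d a x => by
        rw [N.smul]
        congr 3
        ring }
  refine ⟨N', ⟨B, fun b => dg b + k, fun b => by have := hb b; show dg b + k ≤ s; omega, i,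
    e.symm.toLinearMap.comp p, ?_, ?_, ii, e.symm.surjective.comp ps, ?_⟩, N, ?_, LinearEquiv.refl _ _, ?_⟩
  · intro z x
    refine (hi (z - k) x).trans ?_
    refine Finsupp.ext fun b => ?_
    change frc dg _ _ _ = frc _ _ _ _
    rw [frc_apply, frc_apply]
    congr 2
    ring
  · intro z x
    apply e.injective
    rw [he]
    simp only [LinearMap.comp_apply, LinearEquiv.coe_coe, LinearEquiv.apply_symm_apply]
    rw [← hp]
    congr 1
    refine Finsupp.ext fun b => ?_
    change frc _ _ _ _ = frc dg _ _ _
    rw [frc_apply, frc_apply]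
    congr 2
    ring
  · intro x
    rw [← ex x]
    simp
  · have : s + 1 - k = s - k + 1 := by ring
    rw [this]; exact hN
  · intro z x
    rfl

lemma Rg.iso {r : ℤ} {A X : GM K σ} (e : X.M ≃ₗ[MvPolynomial σ K] A.M) (he : Gr e.toLinearMap)
    (h : Rg r A) : Rg r X := by
  have := Rg.shift (k := 0) e (fun z x => by rw [sub_zero]; exact he z x) h
  simpa using this

/-- lifting of generators -/
lemma exists_lift {B : Type} {dg : B → ℤ} {A C : GM K σ}
    (q : (B →₀ MvPolynomial σ K) →ₗ[MvPolynomial σ K] C.M) (hq : Gr (A := Fr K σ B dg) q)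
    (p : A.M →ₗ[MvPolynomial σ K] C.M) (hp : Gr p) (hs : Function.Surjective p) :
    ∃ l : (B →₀ MvPolynomial σ K) →ₗ[MvPolynomial σ K] A.M, Gr (A := Fr K σ B dg) l ∧
      ∀ x, p (l x) = q x := by
  choose g hg using fun b => hs (q (Finsupp.single b 1))
  refine ⟨Finsupp.linearCombination _ (fun b => A.c (dg b) (g b)), ?_, ?_⟩
  · apply Gr_of_gen
    intro b
    simp [A.idem]
  · have : p.comp (Finsupp.linearCombination _ (fun b => A.c (dg b) (g b))) = q := by
      ext b
      simp
      rw [hp, hg]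
      exact gen_of_Gr q hq b
    intro x
    exact LinearMap.congr_fun this x

/-- horseshoe -/
lemma Rg.ext {r : ℤ} {A B C : GM K σ} (h : SES A B C) (hA : Rg r A) (hC : Rg r C) : Rg r B := by
  refine ⟨fun r B => ∃ A C, SES A B C ∧ Rg r A ∧ Rg r C, ⟨A, C, h, hA, hC⟩, ?_⟩
  clear h hA hC
  rintro r M ⟨A, C, ⟨i, p, hi, hp, ii, ps, ex⟩, hA, hC⟩
  obtain ⟨NA, ⟨BA, dA, bA, iA, pA, hiA, hpA, iiA, psA, exA⟩, hNA⟩ := hA.step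
  obtain ⟨NC, ⟨BC, dC, bC, iC, pC, hiC, hpC, iiC, psC, exC⟩, hNC⟩ := hC.step
  obtain ⟨l, hl, hl'⟩ := exists_lift pC hpC p hp ps
  let E : ((BA ⊕ BC) →₀ MvPolynomial σ K) ≃ₗ[MvPolynomial σ K]
    (BA →₀ MvPolynomial σ K) × (BC →₀ MvPolynomial σ K) :=
    Finsupp.sumFinsuppLEquivProdFinsupp _
  let π : ((BA ⊕ BC) →₀ MvPolynomial σ K) →ₗ[MvPolynomial σ K] M.M :=
    (LinearMap.coprod (i.comp pA) l).comp E.toLinearMap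
  have hE1 : ∀ x b, (E x).1 b = x (Sum.inl b) := fun x b => rfl
  have hE2 : ∀ x b, (E x).2 b = x (Sum.inr b) := fun x b => rfl
  have hEc : ∀ z x, E (frc (Sum.elim dA dC) z x) = (frc dA z (E x).1, frc dC z (E x).2) := by
    intro z x
    refine Prod.ext (Finsupp.ext fun b => ?_) (Finsupp.ext fun b => ?_)
    · rw [hE1, frc_apply, frc_apply, hE1]; rfl
    · rw [hE2, frc_apply, frc_apply, hE2]; rfl
  have hπ : ∀ x, π x = i (pA (E x).1) + l (E x).2 := fun x => rfl
  have gπ : Gr (A := Fr K σ (BA ⊕ BC) (Sum.elim dA dC)) π := by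
    intro z x
    rw [hπ, hπ, hEc, map_add, ← hi, ← hpA, ← hl]
  have pi0 : ∀ a, p (i a) = 0 := fun a => (ex _).2 ⟨a, rfl⟩
  have sπ : Function.Surjective π := by
    intro m
    obtain ⟨y, hy⟩ := psC (p m)
    obtain ⟨a, ha⟩ := (ex (m - l y)).1 (by rw [map_sub, hl', hy, sub_self])
    obtain ⟨x, rfl⟩ := psA a
    refine ⟨E.symm (x, y), ?_⟩
    rw [hπ, LinearEquiv.apply_symm_apply, ha]
    simp
  refine ⟨GM.ker (A := Fr K σ (BA ⊕ BC) (Sum.elim dA dC)) π gπ, ⟨BA ⊕ BC, Sum.elim dA dC, ?_,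
    SES_ker (A := Fr K σ (BA ⊕ BC) (Sum.elim dA dC)) π gπ sπ⟩, NA, NC, ?_, hNA, hNC⟩
  · rintro (b | b)
    · exact bA b
    · exact bC b
  have pA0 : ∀ a, pA (iA a) = 0 := fun a => (exA _).2 ⟨a, rfl⟩
  have pC0 : ∀ a, pC (iC a) = 0 := fun a => (exC _).2 ⟨a, rfl⟩
  -- the maps
  let j : NA.M →ₗ[MvPolynomial σ K] LinearMap.ker π :=
    (E.symm.toLinearMap.comp ((LinearMap.inl _ _ _).comp iA)).codRestrict _ (by
      intro a
      rw [LinearMap.mem_ker, hπ]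
      simp [pA0])
  have hj : ∀ a, E (j a).1 = (iA a, 0) := by
    intro a
    simp [j]
  have hk : ∀ x : LinearMap.ker π, pC (E x.1).2 = 0 := by
    intro x
    have := x.2
    rw [LinearMap.mem_ker, hπ] at this
    have := congrArg p this
    rw [map_add, pi0, hl', zero_add, map_zero] at this
    exact this
  have hk' : ∀ x : LinearMap.ker π, (E x.1).2 ∈ LinearMap.range iC := by
    intro x
    exact (exC _).1 (hk x)
  let eC := LinearEquiv.ofInjective iC iiC
  have heC : ∀ y, iC (eC.symm y) = y.1 := by
    intro y
    have := congrArg Subtype.val (eC.apply_symm_apply y)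
    exact this
  let q : LinearMap.ker π →ₗ[MvPolynomial σ K] NC.M :=
    eC.symm.toLinearMap.comp (((LinearMap.snd _ _ _).comp
      (E.toLinearMap.comp (LinearMap.ker π).subtype)).codRestrict _ hk')
  have hq : ∀ x, iC (q x) = (E x.1).2 := fun x => heC _
  refine ⟨j, q, ?_, ?_, ?_, ?_, ?_⟩
  · intro z a
    apply Subtype.ext
    apply E.injective
    rw [hj]
    change _ = E (frc _ z (j a).1)
    rw [hEc, hj, hiA]
    simp
  · intro z x
    apply iiC
    rw [hq, hiC, hq]
    change (E (frc _ z x.1)).2 = _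
    rw [hEc]
  · intro a b hab
    apply iiA
    have := hj a
    rw [hab, hj] at this
    exact (congrArg Prod.fst this).symm
  · intro y
    obtain ⟨a, ha⟩ := (ex (l (iC y))).1 (by rw [hl', pC0])
    obtain ⟨x, rfl⟩ := psA a
    refine ⟨⟨E.symm (-x, iC y), ?_⟩, ?_⟩
    · rw [LinearMap.mem_ker, hπ]
      simp [ha]
    · apply iiC
      rw [hq]
      simp
  · intro x
    constructor
    · intro hx
      have h2 : (E x.1).2 = 0 := by rw [← hq, hx, map_zero]
      have h1 := x.2
      rw [LinearMap.mem_ker, hπ, h2, map_zero, add_zero] at h1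
      obtain ⟨a, ha⟩ := (exA _).1 (ii (h1.trans (map_zero i).symm))
      refine ⟨a, Subtype.ext (E.injective ?_)⟩
      rw [hj, ha]
      exact Prod.ext rfl h2.symm
    · rintro ⟨a, rfl⟩
      apply iiC
      rw [hq, hj, map_zero]

lemma SES.comp {N X Y A Z : GM K σ} (h1 : SES N X Y) (h2 : SES A Y Z) :
    ∃ N', SES N' X Z ∧ SES N N' A := by
  obtain ⟨i, p, hi, hp, ii, ps, ex⟩ := h1
  obtain ⟨i', p', hi', hp', ii', ps', ex'⟩ := h2
  have hg : Gr (p'.comp p) := by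
    intro z x
    rw [LinearMap.comp_apply, LinearMap.comp_apply, hp, hp']
  refine ⟨GM.ker (p'.comp p) hg, SES_ker _ hg (ps'.comp ps), ?_⟩
  have p0 : ∀ a, p (i a) = 0 := fun a => (ex _).2 ⟨a, rfl⟩
  have p0' : ∀ a, p' (i' a) = 0 := fun a => (ex' _).2 ⟨a, rfl⟩
  let j : N.M →ₗ[MvPolynomial σ K] LinearMap.ker (p'.comp p) :=
    i.codRestrict _ (by intro a; simp [p0])
  have hj : ∀ a, (j a).1 = i a := fun a => rfl
  let e := LinearEquiv.ofInjective i' ii'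
  have he : ∀ y, i' (e.symm y) = y.1 := fun y => congrArg Subtype.val (e.apply_symm_apply y)
  let q : LinearMap.ker (p'.comp p) →ₗ[MvPolynomial σ K] A.M :=
    e.symm.toLinearMap.comp ((p.comp (LinearMap.ker (p'.comp p)).subtype).codRestrict _
      (fun x => (ex' _).1 x.2))
  have hq : ∀ x, i' (q x) = p x.1 := fun x => he _
  refine ⟨j, q, ?_, ?_, ?_, ?_, ?_⟩
  · intro z a
    exact Subtype.ext (hi z a)
  · intro z x
    apply ii'
    rw [hq, hi', hq, ← hp]
    rfl
  · intro a b hab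
    exact ii (congrArg Subtype.val hab)
  · intro a
    obtain ⟨x, hx⟩ := ps (i' a)
    refine ⟨⟨x, by rw [LinearMap.mem_ker, LinearMap.comp_apply, hx, p0']⟩, ii' ?_⟩
    rw [hq, hx]
  · intro x
    constructor
    · intro hx
      have : p x.1 = 0 := by rw [← hq, hx, map_zero]
      obtain ⟨a, ha⟩ := (ex _).1 this
      exact ⟨a, Subtype.ext ha⟩
    · rintro ⟨a, rfl⟩
      apply ii'
      rw [hq, hj, p0, map_zero]

lemma Rg.quo {r : ℤ} {A B C : GM K σ} (h : SES A B C) (hA : Rg (r + 1) A) (hB : Rg r B) :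
    Rg r C := by
  obtain ⟨N, ⟨X, dg, hb, hS⟩, hN⟩ := hB.step
  obtain ⟨N', h1, h2⟩ := hS.comp h
  exact Rg.of_step ⟨X, dg, hb, h1⟩ (Rg.ext h2 hN hA)

lemma Rg.zero {r : ℤ} {A : GM K σ} (h : Subsingleton A.M) : Rg r A := by
  refine ⟨fun _ A => Subsingleton A.M, h, ?_⟩
  intro s N hN
  refine ⟨N, ⟨Empty, fun _ => 0, fun b => b.elim, 0, 0, ?_, ?_, ?_, ?_, ?_⟩, hN⟩
  · intro z x; simp
  · intro z x; simp
  · intro a b _; exact Subsingleton.elim _ _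
  · intro a; exact ⟨0, Subsingleton.elim _ _⟩
  · intro x
    exact ⟨fun _ => ⟨0, Subsingleton.elim _ _⟩, fun _ => rfl⟩

lemma Rg.free {r : ℤ} {B : Type} {dg : B → ℤ} (h : ∀ b, dg b ≤ r) : Rg r (Fr K σ B dg) := by
  have hg : Gr (A := Fr K σ B dg) (B := Fr K σ B dg) LinearMap.id := fun z x => rfl
  refine Rg.of_step (N := GM.ker (A := Fr K σ B dg) (B := Fr K σ B dg) LinearMap.id hg)
    ⟨B, dg, h, SES_ker _ hg Function.surjective_id⟩ (Rg.zero ?_)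
  constructor
  intro a b
  apply Subtype.ext
  have h1 := a.2
  have h2 := b.2
  rw [LinearMap.mem_ker, LinearMap.id_apply] at h1 h2
  rw [h1, h2]

lemma Rg.subm {r : ℤ} {A B C : GM K σ} (h : SES A B C) (hB : Rg r B) (hC : Rg (r - 1) C) :
    Rg r A := by
  obtain ⟨N, ⟨X, dg, hb, iC, pC, hiC, hpC, iiC, psC, exC⟩, hN⟩ := hC.step
  obtain ⟨i, p, hi, hp, ii, ps, ex⟩ := h
  obtain ⟨l, hl, hl'⟩ := exists_lift pC hpC p hp ps
  have p0 : ∀ a, p (i a) = 0 := fun a => (ex _).2 ⟨a, rfl⟩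
  have pC0 : ∀ a, pC (iC a) = 0 := fun a => (exC _).2 ⟨a, rfl⟩
  let F := Fr K σ X dg
  have hS : SES N (A.prod F) B := by
    let e := LinearEquiv.ofInjective i ii
    have he : ∀ y, i (e.symm y) = y.1 := fun y => congrArg Subtype.val (e.apply_symm_apply y)
    let q : N.M →ₗ[MvPolynomial σ K] A.M :=
      e.symm.toLinearMap.comp ((l.comp iC).codRestrict _
        (fun x => (ex _).1 (by rw [LinearMap.comp_apply, hl', pC0])))
    have hq : ∀ x, i (q x) = l (iC x) := fun x => he _
    refine ⟨(-q).prod iC, i.coprod l, ?_, ?_, ?_, ?_, ?_⟩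
    · intro z x
      refine Prod.ext (ii ?_) (hiC z x)
      change i (- q (N.c z x)) = i (A.c z (- q x))
      rw [map_neg, map_neg, map_neg, hq, hi, hq, hiC, hl]
    · intro z x
      change i (A.c z x.1) + l (F.c z x.2) = B.c z (i x.1 + l x.2)
      rw [map_add, hi, hl]
    · intro a b hab
      exact iiC (congrArg Prod.snd hab)
    · intro b
      obtain ⟨y, hy⟩ := psC (p b)
      obtain ⟨a, ha⟩ := (ex (b - l y)).1 (by rw [map_sub, hl', hy, sub_self])
      refine ⟨(a, y), ?_⟩
      change i a + l y = b
      rw [ha]; simp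
    · rintro ⟨a, y⟩
      constructor
      · intro h
        change i a + l y = 0 at h
        have h2 := congrArg p h
        rw [map_add, p0, hl', zero_add, map_zero] at h2
        obtain ⟨n, rfl⟩ := (exC _).1 h2
        refine ⟨n, Prod.ext (ii ?_) rfl⟩
        change i (- q n) = i a
        rw [map_neg, hq]
        exact (eq_neg_of_add_eq_zero_left h).symm
      · rintro ⟨n, hn⟩
        have h1 : - q n = a := congrArg Prod.fst hn
        have h2 : iC n = y := congrArg Prod.snd hn
        change i a + l y = 0
        rw [← h1, ← h2, map_neg, hq]; simp
  have hAF : Rg r (A.prod F) := Rg.ext hS (by simpa using hN) hB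
  obtain ⟨N0, ⟨X0, dg0, hb0, hS0⟩, hN0⟩ := hAF.step
  have hS2 : SES F (A.prod F) A := by
    refine ⟨LinearMap.inr _ _ _, LinearMap.fst _ _ _, ?_, fun z x => rfl,
      LinearMap.inr_injective, LinearMap.fst_surjective, ?_⟩
    · intro z x
      exact Prod.ext (map_zero (A.c z)).symm rfl
    · rintro ⟨a, y⟩
      constructor
      · intro h
        exact ⟨y, Prod.ext h.symm rfl⟩
      · rintro ⟨x, hx⟩
        exact (congrArg Prod.fst hx).symm
  obtain ⟨N', h1, h2⟩ := hS0.comp hS2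
  refine Rg.of_step ⟨X0, dg0, hb0, h1⟩ (Rg.ext h2 hN0 ?_)
  exact Rg.free (fun b => by have := hb b; omega)

/-- the polynomial ring as graded module -/
@[reducible] def SM (K : Type) [Field K] (σ : Type) : GM K σ where
  M := MvPolynomial σ K
  c z := hc z
  idem := hc_idem
  orth := hc_orth
  smul := fun z d a x => hc_monomial_mul z d a x

/-- homogeneous ideals -/
def HI (I : Ideal (MvPolynomial σ K)) : Prop := ∀ z, ∀ p ∈ I, hc z p ∈ I

/-- the ideal as graded module -/
@[reducible] def IM (I : Ideal (MvPolynomial σ K)) (hI : HI I) : GM K σ := (SM K σ).sub I hI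

/-- subquotient `I / J` -/
@[reducible] def SQ (J I : Ideal (MvPolynomial σ K)) (hJ : HI J) (hI : HI I) : GM K σ :=
  (IM I hI).quot (Submodule.comap I.subtype J) (fun z x hx => hJ z x.1 hx)

/-- regularity bound for the subquotient -/
def RQ (r : ℤ) (J I : Ideal (MvPolynomial σ K)) : Prop :=
  ∃ (hJ : HI J) (hI : HI I), Rg r (SQ J I hJ hI)

lemma RQ.mono {r s : ℤ} {J I : Ideal (MvPolynomial σ K)} (h : RQ r J I) (hrs : r ≤ s) : RQ s J I := by
  obtain ⟨h1, h2, h3⟩ := h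
  exact ⟨h1, h2, h3.mono hrs⟩

lemma SES_SQ {J I L : Ideal (MvPolynomial σ K)} (hJ : HI J) (hI : HI I) (hL : HI L)
    (h1 : J ≤ I) (h2 : I ≤ L) : SES (SQ J I hJ hI) (SQ J L hJ hL) (SQ I L hI hL) := by
  refine ⟨Submodule.mapQ _ _ (Submodule.inclusion h2) (show _ ≤ Submodule.comap _ _ from fun x hx => hx),
    Submodule.mapQ _ _ LinearMap.id (show _ ≤ Submodule.comap _ _ from fun x hx => h1 hx), ?_, ?_, ?_, ?_, ?_⟩
  · intro z x
    obtain ⟨x, rfl⟩ := Submodule.Quotient.mk_surjective _ x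
    rfl
  · intro z x
    obtain ⟨x, rfl⟩ := Submodule.Quotient.mk_surjective _ x
    rfl
  · rw [← LinearMap.ker_eq_bot, LinearMap.ker_eq_bot']
    intro x hx
    obtain ⟨x, rfl⟩ := Submodule.Quotient.mk_surjective _ x
    rw [Submodule.mapQ_apply, Submodule.Quotient.mk_eq_zero] at hx
    rw [Submodule.Quotient.mk_eq_zero]
    exact hx
  · intro x
    obtain ⟨x, rfl⟩ := Submodule.Quotient.mk_surjective _ x
    exact ⟨Submodule.Quotient.mk x, rfl⟩
  · intro x
    obtain ⟨x, rfl⟩ := Submodule.Quotient.mk_surjective _ x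
    constructor
    · intro hx
      rw [Submodule.mapQ_apply, Submodule.Quotient.mk_eq_zero] at hx
      exact ⟨Submodule.Quotient.mk ⟨x.1, hx⟩, rfl⟩
    · rintro ⟨y, hy⟩
      obtain ⟨y, rfl⟩ := Submodule.Quotient.mk_surjective _ y
      rw [Submodule.mapQ_apply] at hy
      rw [← hy, Submodule.mapQ_apply, Submodule.Quotient.mk_eq_zero]
      exact y.2

lemma RQ.ext {r : ℤ} {J I L : Ideal (MvPolynomial σ K)} (h1 : J ≤ I) (h2 : I ≤ L)
    (hA : RQ r J I) (hC : RQ r I L) : RQ r J L := by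
  obtain ⟨hJ, hI, hA⟩ := hA
  obtain ⟨_, hL, hC⟩ := hC
  exact ⟨hJ, hL, Rg.ext (SES_SQ hJ hI hL h1 h2) hA hC⟩

lemma RQ.quo {r : ℤ} {J I L : Ideal (MvPolynomial σ K)} (h1 : J ≤ I) (h2 : I ≤ L)
    (hA : RQ (r + 1) J I) (hB : RQ r J L) : RQ r I L := by
  obtain ⟨hJ, hI, hA⟩ := hA
  obtain ⟨_, hL, hB⟩ := hB
  exact ⟨hI, hL, Rg.quo (SES_SQ hJ hI hL h1 h2) hA hB⟩

lemma RQ.subm {r : ℤ} {J I L : Ideal (MvPolynomial σ K)} (h1 : J ≤ I) (h2 : I ≤ L)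
    (hB : RQ r J L) (hC : RQ (r - 1) I L) : RQ r J I := by
  obtain ⟨hJ, hL, hB⟩ := hB
  obtain ⟨hI, _, hC⟩ := hC
  exact ⟨hJ, hI, Rg.subm (SES_SQ hJ hI hL h1 h2) hB hC⟩

/-- equivalence of subquotients with degree shift -/
lemma RQ.equiv {d : ℤ} {J I J' I' : Ideal (MvPolynomial σ K)} (hJ : HI J) (hI : HI I)
    (hJ' : HI J') (hI' : HI I')
    (f : I →ₗ[MvPolynomial σ K] I') (hk : ∀ x, (f x).1 ∈ J' ↔ x.1 ∈ J)
    (hs : ∀ y : I', ∃ x, (y.1 - (f x).1) ∈ J')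
    (hd : ∀ z x, f ((IM I hI).c z x) = (IM I' hI').c (z + d) (f x)) (r : ℤ) :
    RQ r J I ↔ RQ (r + d) J' I' := by
  let g : (SQ J I hJ hI).M →ₗ[MvPolynomial σ K] (SQ J' I' hJ' hI').M :=
    Submodule.mapQ _ _ f (show _ ≤ Submodule.comap _ _ from fun x hx => (hk x).2 hx)
  have hg : ∀ x, g (Submodule.Quotient.mk x) = Submodule.Quotient.mk (f x) := fun x => rfl
  have hb : Function.Bijective g := by
    constructor
    · rw [← LinearMap.ker_eq_bot, LinearMap.ker_eq_bot']
      intro x hx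
      obtain ⟨x, rfl⟩ := Submodule.Quotient.mk_surjective _ x
      rw [hg, Submodule.Quotient.mk_eq_zero] at hx
      rw [Submodule.Quotient.mk_eq_zero]
      exact (hk x).1 hx
    · intro y
      obtain ⟨y, rfl⟩ := Submodule.Quotient.mk_surjective _ y
      obtain ⟨x, hx⟩ := hs y
      refine ⟨Submodule.Quotient.mk x, ?_⟩
      rw [hg]
      refine ((Submodule.Quotient.eq (Submodule.comap I'.subtype J')).2 ?_).symm
      exact hx
  have hgc : ∀ z x, g ((SQ J I hJ hI).c z x) = (SQ J' I' hJ' hI').c (z + d) (g x) := by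
    intro z x
    obtain ⟨x, rfl⟩ := Submodule.Quotient.mk_surjective _ x
    exact congrArg Submodule.Quotient.mk (hd z x)
  let e := LinearEquiv.ofBijective g hb
  have he : ∀ x, e x = g x := fun x => rfl
  constructor
  · rintro ⟨_, _, h⟩
    refine ⟨hJ', hI', Rg.shift (A := SQ J I hJ hI) (X := SQ J' I' hJ' hI') e.symm ?_ h⟩
    intro z x
    apply e.injective
    rw [LinearEquiv.apply_symm_apply, he, hgc, ← he, LinearEquiv.apply_symm_apply, sub_add_cancel]
  · rintro ⟨_, _, h⟩
    have := Rg.shift (k := -d) (A := SQ J' I' hJ' hI') (X := SQ J I hJ hI) e ?_ h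
    · exact ⟨hJ, hI, by simpa using this⟩
    intro z x
    rw [he, hgc, ← he, sub_neg_eq_add]

lemma hc_mul_hom (z w : ℤ) (s g : MvPolynomial σ K) (hg : IsHomZ g w) :
    hc z (s * g) = hc (z - w) s * g := by
  rw [mul_comm, mul_comm _ g]
  exact (SM K σ).smulH z w g hg s

lemma HI.inf {I J : Ideal (MvPolynomial σ K)} (hI : HI I) (hJ : HI J) : HI (I ⊓ J) :=
  fun z p hp => ⟨hI z p hp.1, hJ z p hp.2⟩

lemma HI.sup {I J : Ideal (MvPolynomial σ K)} (hI : HI I) (hJ : HI J) : HI (I ⊔ J) := by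
  intro z p hp
  obtain ⟨a, ha, b, hb, rfl⟩ := Submodule.mem_sup.1 hp
  rw [map_add]
  exact Submodule.add_mem_sup (hI z a ha) (hJ z b hb)

lemma HI.top : HI (⊤ : Ideal (MvPolynomial σ K)) := fun _ _ _ => Submodule.mem_top

lemma HI.span {G : Set (MvPolynomial σ K)} (h : ∀ g ∈ G, ∃ w, IsHomZ g w) :
    HI (Ideal.span G) := by
  intro z p hp
  induction hp using Submodule.span_induction generalizing z with
  | mem x hx =>
    obtain ⟨w, hw⟩ := h x hx
    have := hc_mul_hom z w 1 x hw
    rw [one_mul] at this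
    rw [this]
    exact Ideal.mul_mem_left _ _ (Ideal.subset_span hx)
  | zero => simp
  | add x y _ _ hx hy => rw [map_add]; exact Ideal.add_mem _ (hx z) (hy z)
  | smul a x _ hx =>
    induction a using MvPolynomial.induction_on' with
    | add p q hp hq => rw [add_smul, map_add]; exact Ideal.add_mem _ hp hq
    | monomial d a =>
      rw [smul_eq_mul, hc_monomial_mul]
      exact Ideal.mul_mem_left _ _ (hx _)

lemma HI.bot : HI (⊥ : Ideal (MvPolynomial σ K)) := by
  intro z p hp
  rw [Submodule.mem_bot] at *
  rw [hp, map_zero]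

lemma HI.mul {I : Ideal (MvPolynomial σ K)} (hI : HI I) {α : MvPolynomial σ K} {d : ℤ}
    (hα : IsHomZ α d) : HI (Ideal.span {α} * I) := by
  intro z p hp
  obtain ⟨a, ha, rfl⟩ := Ideal.mem_span_singleton_mul.1 hp
  rw [mul_comm α a, hc_mul_hom z d _ _ hα, mul_comm _ α]
  exact Ideal.mem_span_singleton_mul.2 ⟨_, hI _ _ ha, rfl⟩

/-- second isomorphism comparison -/
lemma RQ.second {r : ℤ} {A J J' : Ideal (MvPolynomial σ K)} (hA : HI A) (hJ : HI J)
    (hJ' : HI J')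
    (h : ∀ a ∈ A, a ∈ J ↔ a ∈ J') (hR : RQ r J' (A ⊔ J')) : RQ r J (A ⊔ J) := by
  have key : ∀ J (hJ : HI J), RQ r (A ⊓ J) A ↔ RQ (r + 0) J (A ⊔ J) := by
    intro J hJ
    refine RQ.equiv (hA.inf hJ) hA hJ (hA.sup hJ) (Submodule.inclusion le_sup_left) ?_ ?_ ?_ r
    · intro x
      exact ⟨fun h => ⟨x.2, h⟩, fun h => h.2⟩
    · rintro ⟨y, hy⟩
      obtain ⟨a, ha, b, hb, rfl⟩ := Submodule.mem_sup.1 hy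
      refine ⟨⟨a, ha⟩, ?_⟩
      change a + b - a ∈ J
      rwa [add_sub_cancel_left]
    · intro z x
      rw [add_zero]
      rfl
  have e : A ⊓ J = A ⊓ J' := by
    ext x
    exact ⟨fun hx => ⟨hx.1, (h x hx.1).1 hx.2⟩, fun hx => ⟨hx.1, (h x hx.1).2 hx.2⟩⟩
  have h1 := key J hJ
  have h2 := key J' hJ'
  rw [add_zero] at h1 h2
  rw [← h1, e, h2]
  exact hR

/-- multiplication by a nonzerodivisor -/
lemma RQ.mul {r : ℤ} {d : ℤ} {α : MvPolynomial σ K} {J A : Ideal (MvPolynomial σ K)}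
    (hα : IsHomZ α d) (hn : ∀ p, α * p ∈ J → p ∈ J) (hJ : HI J) (hA : HI A) :
    RQ r J A ↔ RQ (r + d) J (Ideal.span {α} * A ⊔ J) := by
  refine RQ.equiv hJ hA hJ ((hA.mul hα).sup hJ)
    (((LinearMap.mulLeft (MvPolynomial σ K) α).comp (Submodule.subtype A)).codRestrict _ ?_)
    ?_ ?_ ?_ r
  · intro x
    exact Submodule.mem_sup_left (Ideal.mem_span_singleton_mul.2 ⟨x.1, x.2, rfl⟩)
  · intro x
    exact ⟨fun h => hn _ h, fun h => Ideal.mul_mem_left _ _ h⟩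
  · rintro ⟨y, hy⟩
    obtain ⟨a, ha, b, hb, rfl⟩ := Submodule.mem_sup.1 hy
    obtain ⟨a, ha', rfl⟩ := Ideal.mem_span_singleton_mul.1 ha
    refine ⟨⟨a, ha'⟩, ?_⟩
    change α * a + b - α * a ∈ J
    rwa [add_sub_cancel_left]
  · intro z x
    apply Subtype.ext
    change α * hc z x.1 = hc (z + d) (α * x.1)
    rw [mul_comm _ x.1, hc_mul_hom _ _ _ _ hα, add_sub_cancel_right, mul_comm]

lemma Rg_IM {r : ℤ} {I : Ideal (MvPolynomial σ K)} (hI : HI I) : Rg r (IM I hI) ↔ RQ r ⊥ I := by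
  let g : (IM I hI).M →ₗ[MvPolynomial σ K] (SQ ⊥ I HI.bot hI).M := Submodule.mkQ _
  have hb : Function.Bijective g := by
    constructor
    · rw [← LinearMap.ker_eq_bot, LinearMap.ker_eq_bot']
      intro x hx
      have := (Submodule.Quotient.mk_eq_zero _).1 hx
      exact Subtype.ext this
    · exact Submodule.mkQ_surjective _
  let e := LinearEquiv.ofBijective g hb
  have he : ∀ z x, e ((IM I hI).c z x) = (SQ ⊥ I HI.bot hI).c z (e x) := fun z x => rfl
  constructor
  · intro h
    refine ⟨HI.bot, hI, Rg.iso (A := IM I hI) (X := SQ ⊥ I HI.bot hI) e.symm ?_ h⟩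
    intro z x
    apply e.injective
    change e (e.symm _) = e ((IM I hI).c z (e.symm x))
    rw [he, LinearEquiv.apply_symm_apply, LinearEquiv.apply_symm_apply]
  · rintro ⟨_, _, h⟩
    exact Rg.iso (A := SQ ⊥ I HI.bot hI) (X := IM I hI) e he h

lemma isHomZ_one : IsHomZ (1 : MvPolynomial σ K) 0 := by
  classical
  intro d hd
  rw [MvPolynomial.mem_support_iff, MvPolynomial.coeff_one] at hd
  have : d = 0 := by
    by_contra hne
    exact hd (if_neg (Ne.symm hne))
  simp [this]

lemma RQ.top0 {K : Type} [Field K] {σ : Type} : RQ 0 (⊥ : Ideal (MvPolynomial σ K)) ⊤ := by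
  rw [← Rg_IM HI.top]
  let e : (⊤ : Ideal (MvPolynomial σ K)) ≃ₗ[MvPolynomial σ K] (Unit →₀ MvPolynomial σ K) :=
    Submodule.topEquiv.trans (Finsupp.uniqueLinearEquiv _ _ ()).symm
  refine Rg.iso (A := Fr K σ Unit (fun _ => 0)) (X := IM ⊤ HI.top) e ?_
    (Rg.free (fun _ => le_refl _))
  intro z x
  refine Finsupp.ext fun b => ?_
  change _ = frc _ _ _ _
  rw [frc_apply, sub_zero]
  simp [e]
  rfl

/-- lower bound for the ring -/
lemma RQ.top_nonneg {r : ℤ} (h : RQ r (⊥ : Ideal (MvPolynomial σ K)) ⊤) : 0 ≤ r := by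
  rw [← Rg_IM HI.top] at h
  by_contra hr
  obtain ⟨N, ⟨B, dg, hb, i, p, hi, hp, ii, ps, ex⟩, hN⟩ := h.step
  have h0 : p = 0 := by
    refine Finsupp.lhom_ext' fun b => ?_
    ext1
    have h1 := gen_of_Gr p hp b
    have h2 : hc (dg b) (p (Finsupp.single b 1)).1 = (p (Finsupp.single b 1)).1 :=
      congrArg Subtype.val h1
    apply Subtype.ext
    change (p (Finsupp.single b 1)).1 = 0
    rw [← h2]
    ext d
    classical
    rw [coeff_hc, if_neg]
    · simp
    · have := dgZ_nonneg d
      have := hb b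
      omega
  obtain ⟨x, hx⟩ := ps ⟨1, Submodule.mem_top⟩
  rw [h0] at hx
  exact one_ne_zero (congrArg Subtype.val hx).symm

/-- descent along a nonzerodivisor -/
lemma RQ.descend {r s d : ℤ} {α : MvPolynomial σ K} {J : Ideal (MvPolynomial σ K)}
    (hα : IsHomZ α d) (hd : 1 ≤ d) (hn : ∀ p, α * p ∈ J → p ∈ J) (hs : RQ s J ⊤)
    (hr : RQ r (Ideal.span {α} * ⊤ ⊔ J) ⊤) : RQ (r + 1 - d) J ⊤ := by
  have key : ∀ k : ℕ, ∀ s : ℤ, s ≤ r + 1 - d + k → RQ s J ⊤ → RQ (r + 1 - d) J ⊤ := by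
    intro k
    induction k with
    | zero => intro s h1 h2; exact h2.mono (by simpa using h1)
    | succ k ih =>
      intro s h1 h2
      have h3 : RQ (max s (r + 1)) J (Ideal.span {α} * ⊤ ⊔ J) :=
        RQ.subm le_sup_right le_top (h2.mono (le_max_left _ _)) (hr.mono (by
          have := le_max_right s (r + 1); omega))
      obtain ⟨hJ, hT, _⟩ := h2
      have h4 := (RQ.mul (r := max s (r + 1) - d) hα hn hJ hT).2 (by simpa using h3)
      refine ih _ ?_ h4
      push_cast at h1
      omega
  exact key (s - (r + 1 - d)).toNat s (by omega) hs

/-- the grading subgroups -/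
def GM.gr (A : GM K σ) (z : ℤ) : AddSubgroup A.M where
  carrier := {x | A.c z x = x}
  zero_mem' := by simp
  add_mem' := by
    intro a b ha hb
    simp only [Set.mem_setOf_eq] at *
    rw [map_add, ha, hb]
  neg_mem' := by
    intro a ha
    simp only [Set.mem_setOf_eq] at *
    rw [map_neg, ha]

lemma idealGr_eq (I : Ideal (MvPolynomial σ K)) (hI : HI I) : idealGr I = (IM I hI).gr := by
  funext z
  ext x
  change IsHomZ x.1 z ↔ (IM I hI).c z x = x
  rw [isHomZ_iff]
  exact ⟨fun h => Subtype.ext h, fun h => congrArg Subtype.val h⟩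

lemma Rg_of_res {r : ℤ} {A : GM K σ} (F : GradedFreeResolution (K := K) (σ := σ) A.gr)
    (hF : ∀ i b, F.dg i b ≤ r + i) : Rg r A := by
  refine ⟨fun r A => ∃ F : GradedFreeResolution (K := K) (σ := σ) A.gr,
    ∀ i b, F.dg i b ≤ r + i, ⟨F, hF⟩, ?_⟩
  clear hF F
  rintro r A ⟨F, hF⟩
  have hg : Gr (A := Fr K σ (F.B 0) (F.dg 0)) F.π := Gr_of_gen F.π (fun b => F.π_graded b)
  let N := GM.ker (A := Fr K σ (F.B 0) (F.dg 0)) F.π hg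
  refine ⟨N, ⟨F.B 0, F.dg 0, fun b => by simpa using hF 0 b, SES_ker _ hg F.π_surj⟩, ?_⟩
  let q : (F.B 1 →₀ MvPolynomial σ K) →ₗ[MvPolynomial σ K] N.M :=
    (F.φ 0).codRestrict _ (fun x => (F.exact0 _).2 ⟨x, rfl⟩)
  refine ⟨{ B := fun i => F.B (i + 1)
            dg := fun i => F.dg (i + 1)
            φ := fun i => F.φ (i + 1)
            π := q
            φ_graded := fun i => F.φ_graded (i + 1)
            π_graded := ?_
            π_surj := ?_
            exact0 := ?_
            exact := fun i => F.exact (i + 1) }, ?_⟩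
  · intro b
    exact Subtype.ext ((hom_iff_Fr _ _ _).1 (F.φ_graded 0 b))
  · intro x
    obtain ⟨y, hy⟩ := (F.exact0 _).1 x.2
    exact ⟨y, Subtype.ext hy⟩
  · intro x
    rw [← F.exact 0 x]
    exact ⟨fun h => congrArg Subtype.val h, fun h => Subtype.ext h⟩
  · intro i b
    have := hF (i + 1) b
    push_cast at this
    change F.dg (i + 1) b ≤ r + 1 + i
    omega

/-- successive syzygies -/
def syz (r : ℤ) (A : GM K σ) (h : Rg r A) : (i : ℕ) → {N : GM K σ // Rg (r + i) N}
  | 0 => ⟨A, by simpa using h⟩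
  | i + 1 => ⟨Classical.choose (syz r A h i).2.step, by
      have := (Classical.choose_spec (syz r A h i).2.step).2
      have e : r + (i : ℤ) + 1 = r + ((i + 1 : ℕ) : ℤ) := by push_cast; ring
      exact Eq.subst (motive := fun w => Rg w _) e this⟩

lemma syz_step (r : ℤ) (A : GM K σ) (h : Rg r A) (i : ℕ) :
    Stp (r + i) (syz r A h i).1 (syz r A h (i + 1)).1 :=
  (Classical.choose_spec (syz r A h i).2.step).1

lemma res_of_Rg {r : ℤ} {A : GM K σ} (h : Rg r A) :
    ∃ F : GradedFreeResolution (K := K) (σ := σ) A.gr, ∀ i b, F.dg i b ≤ r + i := by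
  choose B dg hb i p hi hp ii ps ex using syz_step r A h
  refine ⟨{ B := B
            dg := dg
            φ := fun k => (i k).comp (p (k + 1))
            π := p 0
            φ_graded := ?_
            π_graded := ?_
            π_surj := ps 0
            exact0 := ?_
            exact := ?_ }, hb⟩
  · intro k b
    rw [hom_iff_Fr]
    have h1 := gen_of_Gr _ (hp (k + 1)) b
    have h2 := hi k (dg (k + 1) b) (p (k + 1) (Finsupp.single b 1))
    rw [h1] at h2
    exact h2.symm
  · intro b
    exact gen_of_Gr _ (hp 0) b
  · intro x
    refine (ex 0 x).trans ?_
    constructor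
    · rintro ⟨y, rfl⟩
      obtain ⟨w, rfl⟩ := ps 1 y
      exact ⟨w, rfl⟩
    · rintro ⟨w, rfl⟩
      exact ⟨_, rfl⟩
  · intro k x
    have e : i k (p (k + 1) x) = 0 ↔ p (k + 1) x = 0 :=
      ⟨fun h => ii k (h.trans (map_zero _).symm), fun h => by rw [h, map_zero]⟩
    rw [LinearMap.comp_apply, e, ex (k + 1) x]
    constructor
    · rintro ⟨y, rfl⟩
      obtain ⟨w, rfl⟩ := ps (k + 2) y
      exact ⟨w, rfl⟩
    · rintro ⟨w, rfl⟩
      exact ⟨_, rfl⟩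

lemma reg_eq (I : Ideal (MvPolynomial σ K)) (hI : HI I) (t : ℤ) (h1 : Rg t (IM I hI))
    (h2 : ∀ r, Rg r (IM I hI) → t ≤ r) : idealReg I = t := by
  unfold idealReg moduleReg
  apply IsLeast.csInf_eq
  rw [idealGr_eq I hI]
  constructor
  · exact res_of_Rg h1
  · rintro r ⟨F, hF⟩
    exact h2 r (Rg_of_res F hF)

/-- semilinear retracts -/
lemma Rg.retract {τ : Type} (ι : MvPolynomial τ K →+* MvPolynomial σ K)
    (ε : MvPolynomial σ K →+* MvPolynomial τ K) (hει : ∀ s, ε (ι s) = s)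
    (hι : ∀ z s, hc z (ι s) = ι (hc z s)) (hε : ∀ z s, hc z (ε s) = ε (hc z s))
    {r : ℤ} {A : GM K σ} {N : GM K τ} (hA : Rg r A) (i : N.M →+ A.M) (ρ : A.M →+ N.M)
    (hi : ∀ s x, i (s • x) = ι s • i x) (hρ : ∀ s x, ρ (s • x) = ε s • ρ x)
    (hρi : ∀ x, ρ (i x) = x) (hic : ∀ z x, i (N.c z x) = A.c z (i x))
    (hρc : ∀ z x, ρ (A.c z x) = N.c z (ρ x)) : Rg r N := by
  refine ⟨fun r N => ∃ (A : GM K σ) (_ : Rg r A) (i : N.M →+ A.M) (ρ : A.M →+ N.M),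
    (∀ s x, i (s • x) = ι s • i x) ∧ (∀ s x, ρ (s • x) = ε s • ρ x) ∧
    (∀ x, ρ (i x) = x) ∧ (∀ z x, i (N.c z x) = A.c z (i x)) ∧
    (∀ z x, ρ (A.c z x) = N.c z (ρ x)), ⟨A, hA, i, ρ, hi, hρ, hρi, hic, hρc⟩, ?_⟩
  clear hi hρ hρi hic hρc i ρ hA A N
  rintro r N ⟨A, hA, i, ρ, hi, hρ, hρi, hic, hρc⟩
  obtain ⟨_, ⟨B, dg, hb, _, p, _, hp, _, ps, _⟩, _⟩ := hA.step
  have hgen := gen_of_Gr p hp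
  let a : B → A.M := fun b => p (Finsupp.single b 1)
  have ha : ∀ b, A.c (dg b) (a b) = a b := hgen
  let π : ((B ⊕ B) →₀ MvPolynomial σ K) →ₗ[MvPolynomial σ K] A.M :=
    Finsupp.linearCombination _ (Sum.elim (fun b => i (ρ (a b))) (fun b => a b - i (ρ (a b))))
  have hπ1 : ∀ b s, π (Finsupp.single (Sum.inl b) s) = s • i (ρ (a b)) := by
    intro b s; simp [π]
  have hπ2 : ∀ b s, π (Finsupp.single (Sum.inr b) s) = s • (a b - i (ρ (a b))) := by
    intro b s; simp [π]
  have gπ : Gr (A := Fr K σ (B ⊕ B) (Sum.elim dg dg)) π := by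
    apply Gr_of_gen
    rintro (b | b)
    · rw [hπ1, one_smul, ← hic]
      change i (N.c (dg b) _) = _
      rw [← hρc, ha]
    · rw [hπ2, one_smul, map_sub, ← hic]
      change A.c (dg b) _ - i (N.c (dg b) _) = _
      rw [← hρc, ha]
  have sπ : Function.Surjective π := by
    intro x
    obtain ⟨y, rfl⟩ := ps x
    induction y using Finsupp.induction_linear with
    | zero => exact ⟨0, by simp⟩
    | add f g hf hg =>
      obtain ⟨u, hu⟩ := hf
      obtain ⟨v, hv⟩ := hg
      exact ⟨u + v, by rw [map_add, map_add, hu, hv]⟩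
    | single b s =>
      refine ⟨Finsupp.single (Sum.inl b) s + Finsupp.single (Sum.inr b) s, ?_⟩
      rw [map_add, hπ1, hπ2, ← smul_add, add_sub_cancel]
      change s • p _ = _
      rw [← map_smul]; simp
  -- cover of N
  let π' : (B →₀ MvPolynomial τ K) →ₗ[MvPolynomial τ K] N.M :=
    Finsupp.linearCombination _ (fun b => ρ (a b))
  have hπ' : ∀ b s, π' (Finsupp.single b s) = s • ρ (a b) := by
    intro b s; simp [π']
  have gπ' : Gr (A := Fr K τ B dg) π' := by
    apply Gr_of_gen
    intro b
    rw [hπ', one_smul, ← hρc, ha]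
  -- semilinear maps on the covers
  let iF : (B →₀ MvPolynomial τ K) →+ ((B ⊕ B) →₀ MvPolynomial σ K) :=
    Finsupp.liftAddHom (fun b => (Finsupp.singleAddHom (Sum.inl b)).comp ι.toAddMonoidHom)
  let ρF : ((B ⊕ B) →₀ MvPolynomial σ K) →+ (B →₀ MvPolynomial τ K) :=
    Finsupp.liftAddHom (Sum.elim (fun b => (Finsupp.singleAddHom b).comp ε.toAddMonoidHom)
      (fun _ => 0))
  have hiF : ∀ b s, iF (Finsupp.single b s) = Finsupp.single (Sum.inl b) (ι s) := by
    intro b s; simp [iF]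
  have hρF1 : ∀ b s, ρF (Finsupp.single (Sum.inl b) s) = Finsupp.single b (ε s) := by
    intro b s; simp [ρF]
  have hρF2 : ∀ b s, ρF (Finsupp.single (Sum.inr b) s) = 0 := by
    intro b s
    exact (Finsupp.liftAddHom_apply_single _ _ _).trans rfl
  have c1 : ∀ x, π (iF x) = i (π' x) := by
    intro x
    induction x using Finsupp.induction_linear with
    | zero => simp
    | add f g hf hg => simp only [map_add, hf, hg]
    | single b s => rw [hiF, hπ1, hπ', hi]
  have c2 : ∀ x, π' (ρF x) = ρ (π x) := by
    intro x
    induction x using Finsupp.induction_linear with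
    | zero => simp
    | add f g hf hg => simp only [map_add, hf, hg]
    | single b s =>
      rcases b with b | b
      · rw [hρF1, hπ1, hπ', hρ, hρi]
      · rw [hρF2, hπ2, hρ, map_sub, hρi, sub_self, smul_zero, map_zero]
  have c3 : ∀ x, ρF (iF x) = x := by
    intro x
    induction x using Finsupp.induction_linear with
    | zero => simp
    | add f g hf hg => simp only [map_add, hf, hg]
    | single b s => rw [hiF, hρF1, hει]
  have c4 : ∀ s x, iF (s • x) = ι s • iF x := by
    intro s x
    induction x using Finsupp.induction_linear with
    | zero => simp
    | add f g hf hg => simp only [map_add, smul_add, hf, hg]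
    | single b u => rw [Finsupp.smul_single, hiF, hiF, Finsupp.smul_single]; simp
  have c5 : ∀ s x, ρF (s • x) = ε s • ρF x := by
    intro s x
    induction x using Finsupp.induction_linear with
    | zero => simp
    | add f g hf hg => simp only [map_add, smul_add, hf, hg]
    | single b u =>
      rcases b with b | b
      · rw [Finsupp.smul_single, hρF1, hρF1, Finsupp.smul_single]; simp
      · rw [Finsupp.smul_single, hρF2, hρF2, smul_zero]
  have c6 : ∀ z x, iF (frc dg z x) = frc (Sum.elim dg dg) z (iF x) := by
    intro z x
    induction x using Finsupp.induction_linear with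
    | zero => simp
    | add f g hf hg => simp only [map_add, hf, hg]
    | single b u => rw [frc_single, hiF, hiF, frc_single, hι]; rfl
  have c7 : ∀ z x, ρF (frc (Sum.elim dg dg) z x) = frc dg z (ρF x) := by
    intro z x
    induction x using Finsupp.induction_linear with
    | zero => simp
    | add f g hf hg => simp only [map_add, hf, hg]
    | single b u =>
      rcases b with b | b
      · rw [frc_single, hρF1, hρF1, frc_single, hε]; rfl
      · rw [frc_single, hρF2, hρF2, map_zero]
  have sπ' : Function.Surjective π' := by
    intro x
    obtain ⟨y, hy⟩ := sπ (i x)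
    exact ⟨ρF y, by rw [c2, hy, hρi]⟩
  have hS := SES_ker (A := Fr K σ (B ⊕ B) (Sum.elim dg dg)) π gπ sπ
  have hS' := SES_ker (A := Fr K τ B dg) π' gπ' sπ'
  refine ⟨_, ⟨B, dg, hb, hS'⟩, GM.ker (A := Fr K σ (B ⊕ B) (Sum.elim dg dg)) π gπ, ?_, ?_⟩
  · refine Rg.subm hS (Rg.free ?_) (by simpa using hA)
    rintro (b | b)
    · have := hb b; change dg b ≤ _; omega
    · have := hb b; change dg b ≤ _; omega
  · refine ⟨(iF.comp (LinearMap.ker π').subtype.toAddMonoidHom).codRestrict (LinearMap.ker π) ?_,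
      (ρF.comp (LinearMap.ker π).subtype.toAddMonoidHom).codRestrict (LinearMap.ker π') ?_,
      ?_, ?_, ?_, ?_, ?_⟩
    · intro x
      have := x.2
      rw [LinearMap.mem_ker] at this
      change π (iF x.1) = 0
      rw [c1, this, map_zero]
    · intro x
      have := x.2
      rw [LinearMap.mem_ker] at this
      change π' (ρF x.1) = 0
      rw [c2, this, map_zero]
    · intro s x
      exact Subtype.ext (c4 s x.1)
    · intro s x
      exact Subtype.ext (c5 s x.1)
    · intro x
      exact Subtype.ext (c3 x.1)
    · intro z x
      exact Subtype.ext (c6 z x.1)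
    · intro z x
      exact Subtype.ext (c7 z x.1)

open Classical in
/-- set the variable `z` to zero -/
def kill (z : σ) : MvPolynomial σ K →ₐ[K] MvPolynomial σ K :=
  aeval (fun w => if w = z then 0 else X w)

/-- divide by the variable `z` -/
def DD (z : σ) (p : MvPolynomial σ K) : MvPolynomial σ K := p.divMonomial (Finsupp.single z 1)

lemma kill_self (z : σ) : kill z (X z : MvPolynomial σ K) = 0 := by simp [kill]

lemma kill_ne (z w : σ) (h : w ≠ z) : kill z (X w : MvPolynomial σ K) = X w := by simp [kill, h]

lemma kill_monomial (z : σ) (d : σ →₀ ℕ) (a : K) :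
    kill z (monomial d a) = if d z = 0 then monomial d a else 0 := by
  classical
  rw [kill, aeval_monomial]
  split_ifs with h
  · rw [monomial_eq]
    congr 1
    refine Finsupp.prod_congr fun w hw => ?_
    have : w ≠ z := by
      rintro rfl
      exact (Finsupp.mem_support_iff.1 hw) h
    simp [this]
  · have : (d.prod fun i k => (if i = z then (0 : MvPolynomial σ K) else X i) ^ k) = 0 := by
      refine Finset.prod_eq_zero (Finsupp.mem_support_iff.2 h) ?_
      simp [h]
    rw [this, mul_zero]

lemma coeff_kill (z : σ) (p : MvPolynomial σ K) (d : σ →₀ ℕ) :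
    coeff d (kill z p) = if d z = 0 then coeff d p else 0 := by
  classical
  induction p using MvPolynomial.induction_on' with
  | monomial u a =>
    rw [kill_monomial]
    split_ifs with h1 h2 h2
    · rfl
    · rw [coeff_monomial, if_neg]
      rintro rfl; exact h2 h1
    · rw [coeff_zero, coeff_monomial, if_neg]
      rintro rfl; exact h1 h2
    · exact coeff_zero _
  | add p q hp hq =>
    rw [map_add, coeff_add, hp, hq, coeff_add]
    split_ifs <;> simp

lemma coeff_DD (z : σ) (p : MvPolynomial σ K) (d : σ →₀ ℕ) :
    coeff d (DD z p) = coeff (Finsupp.single z 1 + d) p := coeff_divMonomial _ _ _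

lemma DD_add (z : σ) (p q : MvPolynomial σ K) : DD z (p + q) = DD z p + DD z q :=
  add_divMonomial _ _ _

lemma DD_X_mul (z : σ) (p : MvPolynomial σ K) : DD z (X z * p) = p := X_mul_divMonomial _ _

lemma DD_zero (z : σ) : DD z (0 : MvPolynomial σ K) = 0 := zero_divMonomial _

lemma DD_kill (z : σ) (p : MvPolynomial σ K) (h : kill z p = p) : DD z p = 0 := by
  ext d
  rw [coeff_DD, ← h, coeff_kill, if_neg, coeff_zero]
  simp

lemma kill_dec (z : σ) (p : MvPolynomial σ K) : p = kill z p + X z * DD z p := by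
  classical
  ext d
  rw [coeff_add, coeff_kill, coeff_X_mul', coeff_DD]
  by_cases h : d z = 0
  · simp [h]
  · have : z ∈ d.support := Finsupp.mem_support_iff.2 h
    rw [if_neg h, if_pos this, zero_add]
    congr 1
    ext w
    by_cases hw : w = z
    · subst hw; simp; omega
    · simp [Ne.symm hw]

lemma kill_ind (z : σ) (P : MvPolynomial σ K → Prop) (h0 : P 0) (hs : ∀ p, P (DD z p) → P p)
    (p : MvPolynomial σ K) : P p := by
  have key : ∀ n : ℕ, ∀ p : MvPolynomial σ K, (∀ d, coeff d p ≠ 0 → d z < n) → P p := by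
    intro n
    induction n with
    | zero =>
      intro p hp
      have : p = 0 := by
        ext d
        by_contra h
        exact absurd (hp d h) (by omega)
      rw [this]; exact h0
    | succ n ih =>
      intro p hp
      apply hs
      apply ih
      intro d hd
      rw [coeff_DD] at hd
      have := hp _ hd
      simp at this
      omega
  refine key (p.support.sup (fun d => d z) + 1) p ?_
  intro d hd
  have := Finset.le_sup (f := fun d : σ →₀ ℕ => d z) (mem_support_iff.2 hd)
  exact Nat.lt_succ_of_le this

/-- `z`-free ideals -/
def ZF (z : σ) (I : Ideal (MvPolynomial σ K)) : Prop := ∀ p ∈ I, kill z p ∈ I ∧ DD z p ∈ I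

lemma ZF.span {z : σ} {G : Set (MvPolynomial σ K)} (h : ∀ g ∈ G, kill z g = g) :
    ZF z (Ideal.span G) := by
  intro p hp
  have key : ∀ a g, g ∈ G → DD z (a * g) = DD z a * g := by
    intro a g hg
    have e : a * g = kill z a * g + X z * (DD z a * g) := by
      conv_lhs => rw [kill_dec z a]
      ring
    rw [e, DD_add, DD_X_mul, DD_kill, zero_add]
    rw [map_mul, h g hg]
    congr 1
    ext d; rw [coeff_kill, coeff_kill]; split_ifs <;> rfl
  refine Submodule.span_induction (p := fun q _ => ∀ a, kill z (a * q) ∈ Ideal.span G ∧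
    DD z (a * q) ∈ Ideal.span G) ?_ ?_ ?_ ?_ hp 1 |> fun h => by simpa using h
  · intro g hg a
    rw [key a g hg, map_mul, h g hg]
    exact ⟨Ideal.mul_mem_left _ _ (Ideal.subset_span hg), Ideal.mul_mem_left _ _ (Ideal.subset_span hg)⟩
  · intro a
    rw [mul_zero, map_zero, DD_zero]; exact ⟨Ideal.zero_mem _, Ideal.zero_mem _⟩
  · intro x y _ _ hx hy a
    rw [mul_add, map_add, DD_add]
    exact ⟨Ideal.add_mem _ (hx a).1 (hy a).1, Ideal.add_mem _ (hx a).2 (hy a).2⟩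
  · intro s x _ hx a
    rw [smul_eq_mul, ← mul_assoc]
    exact hx _

lemma ZF.sup {z : σ} {I J : Ideal (MvPolynomial σ K)} (hI : ZF z I) (hJ : ZF z J) : ZF z (I ⊔ J) := by
  intro p hp
  obtain ⟨a, ha, b, hb, rfl⟩ := Submodule.mem_sup.1 hp
  rw [map_add, DD_add]
  exact ⟨Submodule.add_mem_sup (hI a ha).1 (hJ b hb).1, Submodule.add_mem_sup (hI a ha).2 (hJ b hb).2⟩

lemma ZF.bot {z : σ} : ZF z (⊥ : Ideal (MvPolynomial σ K)) := by
  intro p hp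
  rw [Submodule.mem_bot] at hp
  rw [hp, map_zero, DD_zero]
  exact ⟨Ideal.zero_mem _, Ideal.zero_mem _⟩

/-- nonzerodivisor modulo an ideal -/
def NZ (α : MvPolynomial σ K) (I : Ideal (MvPolynomial σ K)) : Prop := ∀ p, α * p ∈ I → p ∈ I

lemma ZF.nz {z : σ} {I : Ideal (MvPolynomial σ K)} (hI : ZF z I) : NZ (X z) I := by
  intro p hp
  have := (hI _ hp).2
  rwa [DD_X_mul] at this

lemma isHomZ_X (z : σ) : IsHomZ (X z : MvPolynomial σ K) 1 := by
  classical
  intro d hd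
  rw [mem_support_iff, coeff_X] at hd
  have : Finsupp.single z 1 = d := by
    by_contra h
    exact hd (if_neg h)
  rw [← this]; simp

lemma IsHomZ.mul {p q : MvPolynomial σ K} {a b : ℤ} (hp : IsHomZ p a) (hq : IsHomZ q b) :
    IsHomZ (p * q) (a + b) := by
  rw [isHomZ_iff] at hp ⊢
  rw [hc_mul_hom _ b _ _ hq, add_sub_cancel_right, hp]

lemma IsHomZ.sub {p q : MvPolynomial σ K} {a : ℤ} (hp : IsHomZ p a) (hq : IsHomZ q a) :
    IsHomZ (p - q) a := by
  rw [isHomZ_iff] at *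
  rw [map_sub, hp, hq]

/-- ideals of variables -/
def VZ (K : Type) [Field K] (Z : Finset σ) : Ideal (MvPolynomial σ K) :=
  Ideal.span {g | ∃ z ∈ Z, g = X z}

lemma HI_VZ (Z : Finset σ) : HI (VZ K Z) := by
  apply HI.span
  rintro g ⟨z, _, rfl⟩
  exact ⟨1, isHomZ_X z⟩

lemma ZF_VZ {Z : Finset σ} {z : σ} (h : z ∉ Z) : ZF z (VZ K Z) := by
  apply ZF.span
  rintro g ⟨w, hw, rfl⟩
  exact kill_ne _ _ (fun e => h (e ▸ hw))

lemma RQ_VZ {r : ℤ} {J : Ideal (MvPolynomial σ K)} (hr : RQ r J ⊤) (Z : Finset σ)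
    (hZ : ∀ z ∈ Z, ZF z J) : RQ r (J ⊔ VZ K Z) ⊤ := by
  classical
  induction Z using Finset.induction_on with
  | empty =>
    have : VZ K (∅ : Finset σ) = ⊥ := by
      rw [VZ, Ideal.span_eq_bot]
      rintro x ⟨z, hz, _⟩
      simp at hz
    rwa [this, sup_bot_eq]
  | insert z Z hz ih =>
    have ih := ih (fun w hw => hZ w (Finset.mem_insert_of_mem hw))
    have e : J ⊔ VZ K (insert z Z) = Ideal.span {X z} * ⊤ ⊔ (J ⊔ VZ K Z) := by
      rw [Ideal.mul_top, sup_left_comm]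
      congr 1
      rw [VZ, VZ, ← Ideal.span_union]
      congr 1
      ext g
      simp
    have hI := hr.choose.sup (HI_VZ (K := K) Z)
    have h1 := (RQ.mul (isHomZ_X z) (((hZ z (Finset.mem_insert_self _ _)).sup
      (ZF_VZ hz)).nz) hI HI.top).1 ih
    rw [e]
    exact RQ.quo le_sup_right le_top h1 ih

lemma RQ_VZ0 (Z : Finset σ) : RQ 0 (VZ K Z) ⊤ := by
  have := RQ_VZ (K := K) RQ.top0 Z (fun _ _ => ZF.bot)
  rwa [bot_sup_eq] at this
section bin
variable {V : Type}

/-- the binomial of a pair -/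
def bf (K : Type) [Field K] {V : Type} (u v : V) : MvPolynomial (V ⊕ V) K :=
  X (Sum.inl u) * X (Sum.inr v) - X (Sum.inl v) * X (Sum.inr u)

lemma bf_hom (u v : V) : IsHomZ (bf K u v) 2 :=
  IsHomZ.sub (a := 2) (IsHomZ.mul (isHomZ_X _) (isHomZ_X _)) (IsHomZ.mul (isHomZ_X _) (isHomZ_X _))

lemma kill_bf (z : V ⊕ V) (u v : V) (hu : z ≠ Sum.inl u ∧ z ≠ Sum.inr u)
    (hv : z ≠ Sum.inl v ∧ z ≠ Sum.inr v) : kill z (bf K u v) = bf K u v := by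
  rw [bf, map_sub, map_mul, map_mul, kill_ne _ _ hu.1.symm, kill_ne _ _ hu.2.symm,
    kill_ne _ _ hv.1.symm, kill_ne _ _ hv.2.symm]

lemma kill_bf' (j v : V) (h : j ≠ v) :
    kill (Sum.inl v) (bf K j v) = X (Sum.inl j) * X (Sum.inr v) := by
  rw [bf, map_sub, map_mul, map_mul, kill_self, kill_ne, kill_ne] <;> simp [h]

lemma NZ_bf {I : Ideal (MvPolynomial (V ⊕ V) K)} {j v : V} (hjv : j ≠ v)
    (h1 : ZF (Sum.inl v) I) (h2 : ZF (Sum.inr v) I) (hj : NZ (X (Sum.inl j)) I) :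
    NZ (bf K j v) I := by
  intro h
  refine kill_ind (Sum.inl v) (fun h => bf K j v * h ∈ I → h ∈ I) (fun _ => Ideal.zero_mem _) ?_ h
  intro p ih hp
  have hk := (h1 _ hp).1
  rw [map_mul, kill_bf' _ _ hjv, mul_assoc] at hk
  have hk := h2.nz _ (hj _ hk)
  have e : bf K j v * p - bf K j v * kill (Sum.inl v) p =
      X (Sum.inl v) * (bf K j v * DD (Sum.inl v) p) := by
    conv_lhs => rw [kill_dec (Sum.inl v) p]
    rw [← kill_dec (Sum.inl v) p]
    conv_lhs => rw [← mul_sub]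
    rw [sub_eq_iff_eq_add'.2 (kill_dec (Sum.inl v) p)]
    ring
  have h3 := I.sub_mem hp (I.mul_mem_left (bf K j v) hk)
  rw [e] at h3
  have h4 := ih (h1.nz _ h3)
  rw [kill_dec (Sum.inl v) p]
  exact I.add_mem hk (I.mul_mem_left _ h4)

lemma NZ_step {I : Ideal (MvPolynomial (V ⊕ V) K)} {j v : V} (hjv : j ≠ v)
    (h1 : ZF (Sum.inl v) I) (h2 : ZF (Sum.inr v) I) (hj : NZ (X (Sum.inl j)) I) :
    NZ (X (Sum.inl v)) (Ideal.span {bf K j v} * ⊤ ⊔ I) := by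
  intro h hh
  rw [Ideal.mul_top] at *
  obtain ⟨b, hb, i, hi, e⟩ := Submodule.mem_sup.1 hh
  obtain ⟨a, rfl⟩ := Ideal.mem_span_singleton'.1 hb
  have ek := congrArg (kill (Sum.inl v)) e
  rw [map_add, map_mul, map_mul, kill_bf' _ _ hjv, kill_self, zero_mul] at ek
  have hk : X (Sum.inl j) * (X (Sum.inr v) * kill (Sum.inl v) a) ∈ I := by
    have : X (Sum.inl j) * (X (Sum.inr v) * kill (Sum.inl v) a) = - kill (Sum.inl v) i := by
      linear_combination ek
    rw [this]
    exact I.neg_mem (h1 _ hi).1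
  have hk := h2.nz _ (hj _ hk)
  have h3 : X (Sum.inl v) * (h - bf K j v * DD (Sum.inl v) a) ∈ I := by
    have : X (Sum.inl v) * (h - bf K j v * DD (Sum.inl v) a) =
        i + bf K j v * kill (Sum.inl v) a := by
      linear_combination - e + bf K j v * kill_dec (Sum.inl v) a
    rw [this]
    exact I.add_mem hi (I.mul_mem_left _ hk)
  have h4 := h1.nz _ h3
  have : h = bf K j v * DD (Sum.inl v) a + (h - bf K j v * DD (Sum.inl v) a) := by ring
  rw [this]
  exact Submodule.add_mem_sup (Ideal.mul_mem_right _ _ (Ideal.mem_span_singleton_self _)) h4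

/-- path ideals -/
def PI (K : Type) [Field K] {V : Type} (p : ℕ → V) (k : ℕ) : Ideal (MvPolynomial (V ⊕ V) K) :=
  Ideal.span {g | ∃ i, i + 1 < k ∧ g = bf K (p i) (p (i + 1))}

lemma PI_one (p : ℕ → V) : PI K p 1 = ⊥ := by
  rw [PI, Ideal.span_eq_bot]
  rintro x ⟨i, hi, _⟩
  omega

lemma PI_succ (p : ℕ → V) (k : ℕ) :
    PI K p (k + 2) = Ideal.span {bf K (p k) (p (k + 1))} * ⊤ ⊔ PI K p (k + 1) := by
  rw [Ideal.mul_top, PI, PI, ← Ideal.span_union]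
  congr 1
  ext g
  constructor
  · rintro ⟨i, hi, rfl⟩
    by_cases h : i = k
    · subst h; left; rfl
    · right; exact ⟨i, by omega, rfl⟩
  · rintro (h | ⟨i, hi, rfl⟩)
    · exact ⟨k, by omega, h⟩
    · exact ⟨i, by omega, rfl⟩

lemma HI_PI (p : ℕ → V) (k : ℕ) : HI (PI K p k) := by
  apply HI.span
  rintro g ⟨i, _, rfl⟩
  exact ⟨2, bf_hom _ _⟩

lemma ZF_PI (p : ℕ → V) (k : ℕ) (z : V ⊕ V) (h : ∀ i < k, z ≠ Sum.inl (p i) ∧ z ≠ Sum.inr (p i)) :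
    ZF z (PI K p k) := by
  apply ZF.span
  rintro g ⟨i, hi, rfl⟩
  exact kill_bf _ _ _ (h i (by omega)) (h (i + 1) hi)

lemma ZF_PI' (p : ℕ → V) (t k : ℕ) (hp : ∀ i < t, ∀ j < t, p i = p j → i = j) (hk : k + 1 < t) :
    ZF (Sum.inl (p (k + 1))) (PI K p (k + 1)) ∧ ZF (Sum.inr (p (k + 1))) (PI K p (k + 1)) := by
  constructor
  · apply ZF_PI
    intro i hi
    refine ⟨fun e => ?_, by simp⟩
    have := hp _ hk i (by omega) (Sum.inl_injective e)
    omega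
  · apply ZF_PI
    intro i hi
    refine ⟨by simp, fun e => ?_⟩
    have := hp _ hk i (by omega) (Sum.inr_injective e)
    omega

lemma path_ne (p : ℕ → V) (t k : ℕ) (hp : ∀ i < t, ∀ j < t, p i = p j → i = j) (hk : k + 1 < t) :
    p k ≠ p (k + 1) := by
  intro e
  have := hp k (by omega) (k + 1) hk e
  omega

lemma NZ_PI (p : ℕ → V) (t : ℕ) (hp : ∀ i < t, ∀ j < t, p i = p j → i = j) (k : ℕ) (hk : k < t) :
    NZ (X (Sum.inl (p k))) (PI K p (k + 1)) := by
  induction k with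
  | zero => rw [PI_one]; exact ZF.bot.nz
  | succ k ih =>
    obtain ⟨h1, h2⟩ := ZF_PI' (K := K) p t k hp hk
    rw [PI_succ]
    exact NZ_step (path_ne p t k hp hk) h1 h2 (ih (by omega))

lemma NZ_PI' (p : ℕ → V) (t : ℕ) (hp : ∀ i < t, ∀ j < t, p i = p j → i = j) (k : ℕ)
    (hk : k + 1 < t) : NZ (bf K (p k) (p (k + 1))) (PI K p (k + 1)) := by
  obtain ⟨h1, h2⟩ := ZF_PI' (K := K) p t k hp hk
  exact NZ_bf (path_ne p t k hp hk) h1 h2 (NZ_PI p t hp k (by omega))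

lemma RQ_PI (p : ℕ → V) (t : ℕ) (hp : ∀ i < t, ∀ j < t, p i = p j → i = j) (k : ℕ) (hk : k < t) :
    RQ (k : ℤ) (PI K p (k + 1)) ⊤ := by
  induction k with
  | zero => rw [PI_one]; exact RQ.top0
  | succ k ih =>
    have ih := ih (by omega)
    have h1 := (RQ.mul (bf_hom _ _) (NZ_PI' (K := K) p t hp k hk) (HI_PI _ _) HI.top).1 ih
    rw [PI_succ]
    refine RQ.quo le_sup_right le_top (h1.mono ?_) (ih.mono ?_) <;> push_cast <;> omega

lemma RQ_PI_low (p : ℕ → V) (t : ℕ) (hp : ∀ i < t, ∀ j < t, p i = p j → i = j) (k : ℕ)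
    (hk : k < t) (h : RQ ((k : ℤ) - 1) (PI K p (k + 1)) ⊤) : False := by
  induction k with
  | zero =>
    rw [PI_one] at h
    have := h.top_nonneg
    norm_num at this
  | succ k ih =>
    apply ih (by omega)
    rw [PI_succ] at h
    have := RQ.descend (bf_hom _ _) (by norm_num) (NZ_PI' (K := K) p t hp k hk)
      (RQ_PI p t hp k (by omega)) h
    exact this.mono (by push_cast; omega)

/-- complete ideals -/
def KI (K : Type) [Field K] {V : Type} (s : Finset V) : Ideal (MvPolynomial (V ⊕ V) K) :=
  Ideal.span {g | ∃ u ∈ s, ∃ v ∈ s, g = bf K u v}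

lemma HI_KI (s : Finset V) : HI (KI K s) := by
  apply HI.span
  rintro g ⟨u, _, v, _, rfl⟩
  exact ⟨2, bf_hom _ _⟩

lemma bf_mem_KI {s : Finset V} {u v : V} (hu : u ∈ s) (hv : v ∈ s) : bf K u v ∈ KI K s :=
  Ideal.subset_span ⟨u, hu, v, hv, rfl⟩

lemma bf_neg (u v : V) : bf K u v = - bf K v u := by rw [bf, bf]; ring

lemma bf_self (u : V) : bf K u u = 0 := by rw [bf]; ring

lemma ZF_KI {s : Finset V} {v : V} (h : v ∉ s) :
    ZF (Sum.inl v) (KI K s) ∧ ZF (Sum.inr v) (KI K s) := by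
  constructor <;>
  · apply ZF.span
    rintro g ⟨a, ha, b, hb, rfl⟩
    have h1 : v ≠ a := fun e => h (e ▸ ha)
    have h2 : v ≠ b := fun e => h (e ▸ hb)
    apply kill_bf <;> simp [h1, h2]

lemma mul_span_mem {σ : Type} {G : Set (MvPolynomial σ K)} {J : Ideal (MvPolynomial σ K)}
    {x : MvPolynomial σ K}
    (h : ∀ g ∈ G, x * g ∈ J) {p : MvPolynomial σ K} (hp : p ∈ Ideal.span G) : x * p ∈ J := by
  induction hp using Submodule.span_induction with
  | mem g hg => exact h g hg
  | zero => rw [mul_zero]; exact J.zero_mem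
  | add a b _ _ ha hb => rw [mul_add]; exact J.add_mem ha hb
  | smul a b _ hb => rw [smul_eq_mul, mul_left_comm]; exact J.mul_mem_left _ hb

lemma KI_le {s : Finset V} {J : Ideal (MvPolynomial (V ⊕ V) K)}
    (h : ∀ u ∈ s, ∀ v ∈ s, bf K u v ∈ J) : KI K s ≤ J := by
  rw [KI, Ideal.span_le]
  rintro g ⟨u, hu, v, hv, rfl⟩
  exact h u hu v hv

lemma KI_mono {s s' : Finset V} (h : s ⊆ s') : KI K s ≤ KI K s' :=
  KI_le fun _ hu _ hv => bf_mem_KI (h hu) (h hv)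

lemma X_mem_VZ {σ : Type} {Z : Finset σ} {z : σ} (h : z ∈ Z) : (X z : MvPolynomial σ K) ∈ VZ K Z :=
  Ideal.subset_span ⟨z, h, rfl⟩

lemma KI_key [DecidableEq V] {s : Finset V} {j v : V} (hj : j ∈ s) :
    Ideal.span {X (Sum.inl j)} * KI K (insert v s) ⊔ KI K s =
    Ideal.span {bf K j v} * VZ K (s.image Sum.inl) ⊔ KI K s := by
  apply le_antisymm
  · refine sup_le ?_ le_sup_right
    rw [Ideal.span_singleton_mul_le_iff]
    intro z hz
    refine mul_span_mem ?_ hz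
    have key : ∀ u ∈ s, X (Sum.inl j) * bf K u v ∈
        Ideal.span {bf K j v} * VZ K (s.image Sum.inl) ⊔ KI K s := by
      intro u hu
      have e : X (Sum.inl j) * bf K u v = bf K j v * X (Sum.inl u) + (- X (Sum.inl v)) * bf K j u := by
        simp only [bf]; ring
      rw [e]
      exact Submodule.add_mem_sup (Ideal.mul_mem_mul (Ideal.mem_span_singleton_self _)
        (X_mem_VZ (Finset.mem_image_of_mem _ hu))) (Ideal.mul_mem_left _ _ (bf_mem_KI hj hu))
    rintro g ⟨a, ha, b, hb, rfl⟩
    rcases Finset.mem_insert.1 ha with rfl | ha'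
    · rcases Finset.mem_insert.1 hb with rfl | hb'
      · rw [bf_self, mul_zero]; exact Ideal.zero_mem _
      · rw [bf_neg a b, mul_neg]
        exact Submodule.neg_mem _ (key b hb')
    · rcases Finset.mem_insert.1 hb with rfl | hb'
      · exact key a ha'
      · exact Submodule.mem_sup_right (Ideal.mul_mem_left _ _ (bf_mem_KI ha' hb'))
  · refine sup_le ?_ le_sup_right
    rw [Ideal.span_singleton_mul_le_iff]
    intro z hz
    refine mul_span_mem ?_ hz
    rintro g ⟨w, hw, rfl⟩
    obtain ⟨u, hu, rfl⟩ := Finset.mem_image.1 hw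
    have e : bf K j v * X (Sum.inl u) = X (Sum.inl j) * bf K u v + X (Sum.inl v) * bf K j u := by
      simp only [bf]; ring
    rw [e]
    exact Submodule.add_mem_sup (Ideal.mul_mem_mul (Ideal.mem_span_singleton_self _)
        (bf_mem_KI (Finset.mem_insert_of_mem hu) (Finset.mem_insert_self _ _)))
        (Ideal.mul_mem_left _ _ (bf_mem_KI hj hu))

lemma NZ_KI [DecidableEq V] {s : Finset V} {j v : V} (hj : j ∈ s) (hv : v ∉ s)
    (hn : NZ (X (Sum.inl j)) (KI K s)) : NZ (X (Sum.inl v)) (KI K (insert v s)) := by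
  have hjv : j ≠ v := fun e => hv (e ▸ hj)
  obtain ⟨h1, h2⟩ := ZF_KI (K := K) hv
  intro h hh
  have h0 : X (Sum.inl j) * (X (Sum.inl v) * h) ∈
      Ideal.span {bf K j v} * VZ K (s.image Sum.inl) ⊔ KI K s := by
    rw [← KI_key hj]
    exact Submodule.mem_sup_left (Ideal.mul_mem_mul (Ideal.mem_span_singleton_self _) hh)
  obtain ⟨b, hb, i, hi, e⟩ := Submodule.mem_sup.1 h0
  obtain ⟨a, ha, rfl⟩ := Ideal.mem_span_singleton_mul.1 hb
  have ek := congrArg (kill (Sum.inl v)) e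
  rw [map_add, map_mul, map_mul, map_mul, kill_bf' _ _ hjv, kill_self, zero_mul, mul_zero] at ek
  have hk : X (Sum.inl j) * (X (Sum.inr v) * kill (Sum.inl v) a) ∈ KI K s := by
    have : X (Sum.inl j) * (X (Sum.inr v) * kill (Sum.inl v) a) = - kill (Sum.inl v) i := by
      linear_combination ek
    rw [this]
    exact Submodule.neg_mem _ (h1 _ hi).1
  have hk := h2.nz _ (hn _ hk)
  have hD : DD (Sum.inl v) a ∈ VZ K (s.image Sum.inl) :=
    (ZF_VZ (by simpa using hv) a ha).2
  have h3 : X (Sum.inl v) * (X (Sum.inl j) * h - bf K j v * DD (Sum.inl v) a) ∈ KI K s := by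
    have : X (Sum.inl v) * (X (Sum.inl j) * h - bf K j v * DD (Sum.inl v) a) =
        i + bf K j v * kill (Sum.inl v) a := by
      linear_combination - e + bf K j v * kill_dec (Sum.inl v) a
    rw [this]
    exact Ideal.add_mem _ hi (Ideal.mul_mem_left _ _ hk)
  have h4 := h1.nz _ h3
  have h5 : X (Sum.inl j) * h ∈ Ideal.span {X (Sum.inl j)} * KI K (insert v s) ⊔ KI K s := by
    rw [KI_key hj]
    have : X (Sum.inl j) * h = bf K j v * DD (Sum.inl v) a +
      (X (Sum.inl j) * h - bf K j v * DD (Sum.inl v) a) := by ring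
    rw [this]
    exact Submodule.add_mem_sup (Ideal.mul_mem_mul (Ideal.mem_span_singleton_self _) hD) h4
  obtain ⟨b, hb, i', hi', e'⟩ := Submodule.mem_sup.1 h5
  obtain ⟨g, hg, rfl⟩ := Ideal.mem_span_singleton_mul.1 hb
  have h6 : X (Sum.inl j) * (h - g) ∈ KI K s := by
    have : X (Sum.inl j) * (h - g) = i' := by linear_combination - e'
    rwa [this]
  have h7 := KI_mono (Finset.subset_insert v s) (hn _ h6)
  have : h = (h - g) + g := by ring
  rw [this]
  exact Ideal.add_mem _ h7 hg

lemma RQ_KI' (s : Finset V) : RQ 1 (KI K s) ⊤ ∧ (s.Nonempty → ∃ j ∈ s, NZ (X (Sum.inl j)) (KI K s)) := by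
  classical
  induction s using Finset.induction_on with
  | empty =>
    have : KI K (∅ : Finset V) = ⊥ := by
      rw [eq_bot_iff]; apply KI_le; simp
    rw [this]
    exact ⟨RQ.top0.mono (by norm_num), by simp⟩
  | insert v s hv ih =>
    obtain ⟨ih, ih'⟩ := ih
    rcases s.eq_empty_or_nonempty with rfl | hs
    · have : KI K (insert v (∅ : Finset V)) = ⊥ := by
        rw [eq_bot_iff]
        apply KI_le
        intro a ha b hb
        simp at ha hb
        rw [ha, hb, bf_self]
        exact Ideal.zero_mem _
      rw [this]
      exact ⟨RQ.top0.mono (by norm_num), fun _ => ⟨v, by simp, ZF.bot.nz⟩⟩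
    · obtain ⟨j, hj, hn⟩ := ih' hs
      refine ⟨?_, fun _ => ⟨v, Finset.mem_insert_self _ _, NZ_KI hj hv hn⟩⟩
      have hjv : j ≠ v := fun e => hv (e ▸ hj)
      obtain ⟨h1, h2⟩ := ZF_KI (K := K) hv
      have hle : KI K s ≤ VZ K (s.image Sum.inl) := by
        apply KI_le
        intro a ha b hb
        exact Ideal.sub_mem _ (Ideal.mul_mem_right _ _ (X_mem_VZ (Finset.mem_image_of_mem _ ha)))
          (Ideal.mul_mem_right _ _ (X_mem_VZ (Finset.mem_image_of_mem _ hb)))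
      have r1 : RQ 1 (KI K s) (VZ K (s.image Sum.inl)) :=
        RQ.subm hle le_top ih (by simpa using RQ_VZ0 (K := K) (s.image Sum.inl))
      have r2 := (RQ.mul (bf_hom j v) (NZ_bf hjv h1 h2 hn) (HI_KI s) (HI_VZ _)).1 r1
      rw [← KI_key hj] at r2
      have r3 : RQ 2 (KI K s) (KI K (insert v s)) :=
        (RQ.mul (isHomZ_X _) hn (HI_KI s) (HI_KI _)).2 (r2.mono (by norm_num))
      exact RQ.quo (KI_mono (Finset.subset_insert v s)) le_top (r3.mono (by norm_num)) ih

lemma RQ_KI (s : Finset V) : RQ 1 (KI K s) ⊤ := (RQ_KI' s).1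

end bin
section join
variable {V : Type} [DecidableEq V]

/-- all variables at the vertices of `s` -/
def VV (K : Type) [Field K] {V : Type} [DecidableEq V] (s : Finset V) :
    Ideal (MvPolynomial (V ⊕ V) K) :=
  VZ K (s.image Sum.inl ∪ s.image Sum.inr)

lemma mem_ZZ {s : Finset V} {z : V ⊕ V} (h : z ∈ s.image Sum.inl ∪ s.image Sum.inr) :
    ∃ v ∈ s, z = Sum.inl v ∨ z = Sum.inr v := by
  rcases Finset.mem_union.1 h with h | h
  · obtain ⟨v, hv, rfl⟩ := Finset.mem_image.1 h
    exact ⟨v, hv, Or.inl rfl⟩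
  · obtain ⟨v, hv, rfl⟩ := Finset.mem_image.1 h
    exact ⟨v, hv, Or.inr rfl⟩

lemma xl_mem {s : Finset V} {v : V} (h : v ∈ s) : X (Sum.inl v) ∈ VV K s :=
  X_mem_VZ (Finset.mem_union_left _ (Finset.mem_image_of_mem _ h))

lemma xr_mem {s : Finset V} {v : V} (h : v ∈ s) : X (Sum.inr v) ∈ VV K s :=
  X_mem_VZ (Finset.mem_union_right _ (Finset.mem_image_of_mem _ h))

lemma bf_mem_left {s : Finset V} {u v : V} (h : u ∈ s) : bf K u v ∈ VV K s :=
  Ideal.sub_mem _ (Ideal.mul_mem_right _ _ (xl_mem h)) (Ideal.mul_mem_left _ _ (xr_mem h))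

lemma bf_mem_right {s : Finset V} {u v : V} (h : v ∈ s) : bf K u v ∈ VV K s := by
  rw [bf_neg]
  exact Submodule.neg_mem _ (bf_mem_left h)

lemma inf_VZ {σ : Type} {J : Ideal (MvPolynomial σ K)} (Z : Finset σ) (hZ : ∀ z ∈ Z, ZF z J)
    (p : MvPolynomial σ K) (h1 : p ∈ J) (h2 : p ∈ VZ K Z) : p ∈ VZ K Z * J := by
  classical
  induction Z using Finset.induction_on generalizing p with
  | empty =>
    have : VZ K (∅ : Finset σ) = ⊥ := by
      rw [VZ, Ideal.span_eq_bot]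
      rintro x ⟨z, hz, _⟩
      simp at hz
    rw [this, Submodule.mem_bot] at h2
    rw [h2]; exact Ideal.zero_mem _
  | insert z Z hz ih =>
    have hle : VZ K Z ≤ VZ K (insert z Z) :=
      Ideal.span_mono (fun g ⟨w, hw, e⟩ => ⟨w, Finset.mem_insert_of_mem hw, e⟩)
    have hJ := hZ z (Finset.mem_insert_self _ _) p h1
    have hk : kill z p ∈ VZ K Z := by
      have e : VZ K (insert z Z) = Ideal.span {X z} ⊔ VZ K Z := by
        rw [VZ, VZ, ← Ideal.span_union]
        congr 1
        ext g
        simp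
      rw [e] at h2
      obtain ⟨b, hb, w, hw, rfl⟩ := Submodule.mem_sup.1 h2
      obtain ⟨a, rfl⟩ := Ideal.mem_span_singleton'.1 hb
      rw [map_add, map_mul, kill_self, mul_zero, zero_add]
      exact (ZF_VZ hz w hw).1
    have h3 := ih (fun w hw => hZ w (Finset.mem_insert_of_mem hw)) _ hJ.1 hk
    rw [kill_dec z p]
    exact Ideal.add_mem _ (Ideal.mul_mono_left hle h3)
      (Ideal.mul_mem_mul (X_mem_VZ (Finset.mem_insert_self _ _)) hJ.2)

lemma ZF_KI_all {s s' : Finset V} (hd : Disjoint s s') :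
    ∀ z ∈ s'.image Sum.inl ∪ s'.image Sum.inr, ZF z (KI K s) := by
  intro z hz
  obtain ⟨v, hv, h⟩ := mem_ZZ hz
  have h0 := ZF_KI (K := K) (Finset.disjoint_right.1 hd hv)
  rcases h with rfl | rfl
  · exact h0.1
  · exact h0.2

lemma inf_KI {s s' : Finset V} (hd : Disjoint s s') {M : Ideal (MvPolynomial (V ⊕ V) K)}
    (hM : ∀ u ∈ s, ∀ v ∈ s', bf K u v ∈ M) {p : MvPolynomial (V ⊕ V) K}
    (h1 : p ∈ KI K s) (h2 : p ∈ VV K s') : p ∈ M := by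
  have h3 := inf_VZ _ (ZF_KI_all hd) p h1 h2
  refine (show VZ K _ * KI K s ≤ M from ?_) h3
  rw [Ideal.mul_le]
  intro a ha b hb
  rw [mul_comm]
  refine mul_span_mem ?_ ha
  rintro g ⟨z, hz, rfl⟩
  rw [mul_comm]
  refine mul_span_mem ?_ hb
  rintro g ⟨a, ha, b, hb, rfl⟩
  obtain ⟨v, hv, h⟩ := mem_ZZ hz
  have hM1 := hM a ha v hv
  have hM2 := hM b hb v hv
  rcases h with rfl | rfl
  · have e : X (Sum.inl v) * bf K a b = X (Sum.inl b) * bf K a v - X (Sum.inl a) * bf K b v := by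
      simp only [bf]; ring
    rw [e]
    exact Ideal.sub_mem _ (Ideal.mul_mem_left _ _ hM1) (Ideal.mul_mem_left _ _ hM2)
  · have e : X (Sum.inr v) * bf K a b = X (Sum.inr b) * bf K a v - X (Sum.inr a) * bf K b v := by
      simp only [bf]; ring
    rw [e]
    exact Ideal.sub_mem _ (Ideal.mul_mem_left _ _ hM1) (Ideal.mul_mem_left _ _ hM2)

/-- join ideal -/
def MI (K : Type) [Field K] {V : Type} (s s' : Finset V) : Ideal (MvPolynomial (V ⊕ V) K) :=
  Ideal.span {g | ∃ u ∈ s, ∃ v ∈ s', g = bf K u v}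

lemma HI_MI (s s' : Finset V) : HI (MI K s s') := by
  apply HI.span
  rintro g ⟨u, _, v, _, rfl⟩
  exact ⟨2, bf_hom _ _⟩

lemma bf_mem_MI {s s' : Finset V} {u v : V} (hu : u ∈ s) (hv : v ∈ s') : bf K u v ∈ MI K s s' :=
  Ideal.subset_span ⟨u, hu, v, hv, rfl⟩

lemma MI_le {s s' : Finset V} {J : Ideal (MvPolynomial (V ⊕ V) K)}
    (h : ∀ u ∈ s, ∀ v ∈ s', bf K u v ∈ J) : MI K s s' ≤ J := by
  rw [MI, Ideal.span_le]
  rintro g ⟨u, hu, v, hv, rfl⟩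
  exact h u hu v hv

lemma KI_le_VV (s : Finset V) : KI K s ≤ VV K s := KI_le fun _ hu _ _ => bf_mem_left hu

lemma RQ_join (p : ℕ → V) (k : ℕ) (hk : 2 ≤ k)
    (hp : ∀ i < k + 1, ∀ j < k + 1, p i = p j → i = j)
    (s s' : Finset V) (hd : Disjoint s s') (hps : ∀ i < k + 1, p i ∈ s) :
    RQ (k : ℤ) (PI K p (k + 1) ⊔ MI K s s') ⊤ := by
  have hPA : PI K p (k + 1) ≤ KI K s := by
    rw [PI, Ideal.span_le]
    rintro g ⟨i, hi, rfl⟩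
    exact bf_mem_KI (hps i (by omega)) (hps _ hi)
  have hMV : MI K s s' ≤ VV K s' := MI_le fun _ _ _ hv => bf_mem_right hv
  have hMV' : MI K s s' ≤ VV K s := MI_le fun _ hu _ _ => bf_mem_left hu
  have hJ : HI (PI K p (k + 1) ⊔ MI K s s') := (HI_PI p _).sup (HI_MI s s')
  have hJ' : HI (KI K s ⊔ (PI K p (k + 1) ⊔ MI K s s')) := (HI_KI s).sup hJ
  have s1 : RQ (k : ℤ) (PI K p (k + 1) ⊔ MI K s s') (KI K s ⊔ (PI K p (k + 1) ⊔ MI K s s')) := by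
    refine RQ.second (J' := PI K p (k + 1) ⊔ VV K s') (HI_KI s) hJ ((HI_PI p _).sup (HI_VZ _)) ?_ ?_
    · intro a ha
      constructor
      · exact fun h => sup_le_sup_left hMV _ h
      · intro h
        obtain ⟨q, hq, w, hw, rfl⟩ := Submodule.mem_sup.1 h
        refine Submodule.add_mem_sup hq ?_
        have hw' : w ∈ KI K s := by
          have := Ideal.sub_mem _ ha (hPA hq)
          rwa [add_sub_cancel_left] at this
        exact inf_KI hd (fun u hu v hv => bf_mem_MI hu hv) hw' hw
    · have e : KI K s ⊔ (PI K p (k + 1) ⊔ VV K s') = KI K s ⊔ VV K s' := by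
        rw [← sup_assoc, sup_eq_left.2 hPA]
      rw [e]
      refine RQ.subm (sup_le_sup_right hPA _) le_top (RQ_VZ (RQ_PI p _ hp k (by omega)) _ ?_)
        ((RQ_VZ (RQ_KI s) _ (ZF_KI_all hd)).mono ?_)
      · intro z hz
        obtain ⟨v, hv, h⟩ := mem_ZZ hz
        apply ZF_PI
        intro i hi
        have : v ≠ p i := fun e => Finset.disjoint_right.1 hd hv (e ▸ hps i hi)
        rcases h with rfl | rfl <;> simp [this]
      · omega
  have s2 : RQ 2 (KI K s ⊔ (PI K p (k + 1) ⊔ MI K s s'))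
      (KI K s' ⊔ (KI K s ⊔ (PI K p (k + 1) ⊔ MI K s s'))) := by
    refine RQ.second (J' := VV K s) (HI_KI s') hJ' (HI_VZ _) ?_ ?_
    · intro b hb
      constructor
      · have : KI K s ⊔ (PI K p (k + 1) ⊔ MI K s s') ≤ VV K s :=
          sup_le (KI_le_VV s) (sup_le (hPA.trans (KI_le_VV s)) hMV')
        exact fun h => this h
      · intro h
        refine inf_KI hd.symm ?_ hb h
        intro u hu v hv
        rw [bf_neg]
        exact Submodule.neg_mem _ (Submodule.mem_sup_right (Submodule.mem_sup_right (bf_mem_MI hv hu)))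
    · exact RQ.subm le_sup_right le_top ((RQ_VZ0 _).mono (by norm_num))
        ((RQ_VZ (RQ_KI s') _ (ZF_KI_all hd.symm)).mono (by norm_num))
  have s3 : KI K s' ⊔ (KI K s ⊔ (PI K p (k + 1) ⊔ MI K s s')) = KI K (s ∪ s') := by
    apply le_antisymm
    · refine sup_le (KI_mono Finset.subset_union_right) (sup_le (KI_mono Finset.subset_union_left)
        (sup_le (hPA.trans (KI_mono Finset.subset_union_left)) (MI_le ?_)))
      intro u hu v hv
      exact bf_mem_KI (Finset.mem_union_left _ hu) (Finset.mem_union_right _ hv)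
    · apply KI_le
      intro u hu v hv
      rcases Finset.mem_union.1 hu with hu | hu <;> rcases Finset.mem_union.1 hv with hv | hv
      · exact Submodule.mem_sup_right (Submodule.mem_sup_left (bf_mem_KI hu hv))
      · exact Submodule.mem_sup_right (Submodule.mem_sup_right (Submodule.mem_sup_right
          (bf_mem_MI hu hv)))
      · rw [bf_neg]
        exact Submodule.neg_mem _ (Submodule.mem_sup_right (Submodule.mem_sup_right
          (Submodule.mem_sup_right (bf_mem_MI hv hu))))
      · exact Submodule.mem_sup_left (bf_mem_KI hu hv)
  refine RQ.ext le_sup_right le_top s1 (RQ.ext le_sup_right le_top (s2.mono (by omega)) ?_)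
  rw [s3]
  exact (RQ_KI _).mono (by omega)

end join
lemma isHomZ_zero (z : ℤ) : IsHomZ (0 : MvPolynomial σ K) z := by
  intro d hd; simp at hd

lemma IsHomZ.pow {p : MvPolynomial σ K} {a : ℤ} (hp : IsHomZ p a) (k : ℕ) :
    IsHomZ (p ^ k) (k * a) := by
  induction k with
  | zero => simpa using isHomZ_one
  | succ k ih =>
    rw [pow_succ]
    have := ih.mul hp
    convert this using 1
    push_cast; ring

open Classical in
lemma hc_of_hom {p : MvPolynomial σ K} {w : ℤ} (h : IsHomZ p w) (z : ℤ) :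
    hc z p = if w = z then p else 0 := by
  rw [isHomZ_iff] at h
  split_ifs with e
  · rw [← e, h]
  · rw [← h]; exact hc_orth _ _ _ (Ne.symm e)

lemma hom_mono {τ : Type} (φ : MvPolynomial σ K →ₐ[K] MvPolynomial τ K)
    (h : ∀ w, IsHomZ (φ (X w)) 1) (d : σ →₀ ℕ) (a : K) : IsHomZ (φ (monomial d a)) (dgZ d) := by
  classical
  induction d using Finsupp.induction with
  | zero =>
    rw [dgZ_zero]
    have : monomial (0 : σ →₀ ℕ) a = C a := rfl
    rw [this, ← mul_one (C a), ← algebraMap_eq, map_mul, map_one, AlgHom.commutes, mul_one]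
    intro d hd
    rw [algebraMap_eq] at hd
    rw [mem_support_iff, coeff_C] at hd
    have : 0 = d := by
      by_contra h
      exact hd (if_neg h)
    rw [← this]; simp
  | single_add i k d _ _ ih =>
    rw [dgZ_add, dgZ_single, ← one_mul a, ← monomial_mul, map_mul]
    refine IsHomZ.mul ?_ ih
    rw [← X_pow_eq_monomial, map_pow]
    simpa using (h i).pow k

lemma hc_comm {τ : Type} (φ : MvPolynomial σ K →ₐ[K] MvPolynomial τ K)
    (h : ∀ w, IsHomZ (φ (X w)) 1) (z : ℤ) (s : MvPolynomial σ K) : hc z (φ s) = φ (hc z s) := by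
  classical
  induction s using MvPolynomial.induction_on' with
  | monomial u a =>
    rw [hc_of_hom (hom_mono φ h u a), hc_monomial]
    split_ifs
    · rfl
    · rw [map_zero]
  | add p q hp hq => rw [map_add, map_add, hp, hq, map_add, map_add]

/-- the standard path -/
def pth (n : ℕ) (hn : 0 < n) (i : ℕ) : Fin n := if h : i < n then ⟨i, h⟩ else ⟨0, hn⟩

lemma pth_val (n : ℕ) (hn : 0 < n) (i : ℕ) (h : i < n) : (pth n hn i).val = i := by simp [pth, h]

lemma be_eq (n t : ℕ) (hn : 0 < n) (htn : t ≤ n) : beIdeal K (pathJoinGraph n t) =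
    PI K (pth n hn) t ⊔ MI K (Finset.univ.filter (fun v : Fin n => v.val < t))
      (Finset.univ.filter (fun v : Fin n => t ≤ v.val)) := by
  apply le_antisymm
  · rw [beIdeal, Ideal.span_le]
    rintro g ⟨i, j, hij, rfl⟩
    change bf K i j ∈ _
    have key : ∀ a b : Fin n, ((a.val + 1 = b.val ∧ b.val < t) ∨ (a.val < t ∧ t ≤ b.val)) →
        bf K a b ∈ PI K (pth n hn) t ⊔ MI K (Finset.univ.filter (fun v : Fin n => v.val < t))
      (Finset.univ.filter (fun v : Fin n => t ≤ v.val)) := by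
      rintro a b (⟨h1, h2⟩ | ⟨h1, h2⟩)
      · apply Submodule.mem_sup_left
        refine Ideal.subset_span ⟨a.val, by omega, ?_⟩
        congr 1
        · ext; rw [pth_val _ _ _ a.2]
        · ext; rw [pth_val _ _ _ (by omega), h1]
      · apply Submodule.mem_sup_right
        exact bf_mem_MI (by simpa using h1) (by simpa using h2)
    have h2 := (SimpleGraph.fromRel_adj _ _ _).1 hij
    rcases h2.2 with h | h
    · exact key _ _ h
    · rw [bf_neg]; exact Submodule.neg_mem _ (key _ _ h)
  · refine sup_le ?_ (MI_le ?_)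
    · rw [PI, Ideal.span_le]
      rintro g ⟨i, hi, rfl⟩
      refine Ideal.subset_span ⟨_, _, ?_, rfl⟩
      refine (SimpleGraph.fromRel_adj _ _ _).2 ⟨?_, Or.inl (Or.inl ?_)⟩
      · intro e
        have := congrArg Fin.val e
        rw [pth_val _ _ _ (by omega), pth_val _ _ _ (by omega)] at this
        omega
      · rw [pth_val _ _ _ (by omega), pth_val _ _ _ (by omega)]
        exact ⟨rfl, hi⟩
    · intro u hu v hv
      simp at hu hv
      refine Ideal.subset_span ⟨u, v, ?_, rfl⟩
      refine (SimpleGraph.fromRel_adj _ _ _).2 ⟨?_, Or.inl (Or.inr ⟨hu, hv⟩)⟩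
      rintro rfl
      omega

lemma pth_inj (n : ℕ) (hn : 0 < n) (t : ℕ) (htn : t ≤ n) :
    ∀ i < t, ∀ j < t, pth n hn i = pth n hn j → i = j := by
  intro i hi j hj e
  have := congrArg Fin.val e
  rwa [pth_val _ _ _ (by omega), pth_val _ _ _ (by omega)] at this

/-- restriction to the path -/
def epsl (K : Type) [Field K] (n t : ℕ) :
    MvPolynomial (Fin n ⊕ Fin n) K →ₐ[K] MvPolynomial (Fin t ⊕ Fin t) K :=
  aeval (Sum.elim (fun v => if h : v.val < t then X (Sum.inl ⟨v.val, h⟩) else 0)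
    (fun v => if h : v.val < t then X (Sum.inr ⟨v.val, h⟩) else 0))

/-- inclusion of the path -/
def iot (K : Type) [Field K] (n t : ℕ) (h : t ≤ n) :
    MvPolynomial (Fin t ⊕ Fin t) K →ₐ[K] MvPolynomial (Fin n ⊕ Fin n) K :=
  rename (Sum.map (Fin.castLE h) (Fin.castLE h))

lemma epsl_bf (n t : ℕ) (u v : Fin n) (hu : u.val < t) (hv : v.val < t) :
    epsl K n t (bf K u v) = bf K ⟨u.val, hu⟩ ⟨v.val, hv⟩ := by
  simp [epsl, bf, hu, hv]

lemma epsl_bf0 (n t : ℕ) (u v : Fin n) (hv : t ≤ v.val) : epsl K n t (bf K u v) = 0 := by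
  simp [epsl, bf, not_lt.2 hv]

lemma iot_bf (n t : ℕ) (h : t ≤ n) (u v : Fin t) :
    iot K n t h (bf K u v) = bf K (Fin.castLE h u) (Fin.castLE h v) := by
  simp [iot, bf]

lemma epsl_iot (n t : ℕ) (h : t ≤ n) (s : MvPolynomial (Fin t ⊕ Fin t) K) :
    epsl K n t (iot K n t h s) = s := by
  have : (epsl K n t).comp (iot K n t h) = AlgHom.id K _ := by
    apply MvPolynomial.algHom_ext
    rintro (v | v) <;> simp [epsl, iot]
  exact congrArg (fun f => f s) this

lemma low (n t : ℕ) (h3 : 3 ≤ t) (htn : t ≤ n) (hJ : HI (beIdeal K (pathJoinGraph n t))) (r : ℤ)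
    (hr : Rg r (IM (beIdeal K (pathJoinGraph n t)) hJ)) : (t : ℤ) ≤ r := by
  have hn : 0 < n := by omega
  have ht : 0 < t := by omega
  have hcast : ∀ i < t, Fin.castLE htn (pth t ht i) = pth n hn i := by
    intro i hi
    ext
    rw [Fin.val_castLE, pth_val _ _ _ hi, pth_val _ _ _ (by omega)]
  have h1 : ∀ x ∈ PI K (pth t ht) t, iot K n t htn x ∈ beIdeal K (pathJoinGraph n t) := by
    intro x hx
    rw [be_eq n t hn htn]
    refine Submodule.mem_sup_left ?_
    revert x hx
    suffices hs : PI K (pth t ht) t ≤ Ideal.comap (iot K n t htn) (PI K (pth n hn) t) from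
      fun x hx => hs hx
    rw [PI, Ideal.span_le]
    rintro g ⟨i, hi, rfl⟩
    rw [SetLike.mem_coe, Ideal.mem_comap]
    rw [iot_bf, hcast i (by omega), hcast _ hi]
    exact Ideal.subset_span ⟨i, hi, rfl⟩
  have h2 : ∀ x ∈ beIdeal K (pathJoinGraph n t), epsl K n t x ∈ PI K (pth t ht) t := by
    rw [be_eq n t hn htn]
    suffices hs : PI K (pth n hn) t ⊔ MI K (Finset.univ.filter (fun v : Fin n => v.val < t))
      (Finset.univ.filter (fun v : Fin n => t ≤ v.val)) ≤
        Ideal.comap (epsl K n t) (PI K (pth t ht) t) from fun x hx => hs hx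
    refine sup_le ?_ (MI_le ?_)
    · rw [PI, Ideal.span_le]
      rintro g ⟨i, hi, rfl⟩
      rw [SetLike.mem_coe, Ideal.mem_comap]
      rw [← hcast i (by omega), ← hcast _ hi, ← iot_bf, epsl_iot]
      exact Ideal.subset_span ⟨i, hi, rfl⟩
    · intro u hu v hv
      simp at hv
      rw [Ideal.mem_comap]
      rw [epsl_bf0 _ _ _ _ hv]
      exact Ideal.zero_mem _
  have cι := hc_comm (iot K n t htn) (by
    intro w; rw [iot, rename_X]; exact isHomZ_X _)
  have cε := hc_comm (epsl K n t) (by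
    rintro (v | v)
    · by_cases h : v.val < t
      · simpa [epsl, h] using isHomZ_X _
      · simpa [epsl, h] using isHomZ_zero _
    · by_cases h : v.val < t
      · simpa [epsl, h] using isHomZ_X _
      · simpa [epsl, h] using isHomZ_zero _)
  have hR : Rg r (IM (PI K (pth t ht) t) (HI_PI _ _)) := by
    refine Rg.retract (iot K n t htn).toRingHom (epsl K n t).toRingHom (epsl_iot n t htn) cι cε hr
      (((iot K n t htn).toRingHom.toAddMonoidHom.comp
        (Submodule.subtype (PI K (pth t ht) t)).toAddMonoidHom).codRestrict
        (beIdeal K (pathJoinGraph n t)) (fun x => h1 x.1 x.2))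
      (((epsl K n t).toRingHom.toAddMonoidHom.comp
        (Submodule.subtype (beIdeal K (pathJoinGraph n t))).toAddMonoidHom).codRestrict
        (PI K (pth t ht) t) (fun x => h2 x.1 x.2)) ?_ ?_ ?_ ?_ ?_
    · intro s x
      exact Subtype.ext (map_mul (iot K n t htn) s x.1)
    · intro s x
      exact Subtype.ext (map_mul (epsl K n t) s x.1)
    · intro x
      exact Subtype.ext (epsl_iot n t htn x.1)
    · intro z x
      exact Subtype.ext (cι z x.1).symm
    · intro z x
      exact Subtype.ext (cε z x.1).symm
  by_contra hlt
  obtain ⟨k, rfl⟩ : ∃ k, t = k + 1 := ⟨t - 1, by omega⟩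
  rw [Rg_IM] at hR
  refine RQ_PI_low (K := K) (pth (k + 1) ht) (k + 1) (pth_inj _ _ _ le_rfl) k (by omega) ?_
  refine RQ.quo bot_le le_top (hR.mono ?_) (RQ.top0.mono ?_)
  · push_cast at hlt; omega
  · omega

lemma HI_be (n t : ℕ) : HI (beIdeal K (pathJoinGraph n t)) := by
  apply HI.span
  rintro g ⟨i, j, _, rfl⟩
  exact ⟨2, bf_hom i j⟩

lemma upp (n t : ℕ) (h3 : 3 ≤ t) (htn : t ≤ n) :
    Rg (t : ℤ) (IM (beIdeal K (pathJoinGraph n t)) (HI_be n t)) := by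
  have hn : 0 < n := by omega
  rw [Rg_IM]
  refine RQ.subm bot_le le_top (RQ.top0.mono (by omega)) ?_
  rw [be_eq n t hn htn]
  obtain ⟨k, rfl⟩ : ∃ k, t = k + 1 := ⟨t - 1, by omega⟩
  refine (RQ_join (K := K) (pth n hn) k (by omega) (pth_inj n hn _ htn) _ _ ?_ ?_).mono ?_
  · rw [Finset.disjoint_filter]
    intro x _ h
    omega
  · intro i hi
    simp only [Finset.mem_filter, Finset.mem_univ, true_and]
    rw [pth_val _ _ _ (by omega)]
    exact hi
  · push_cast; omega

lemma conn (n t : ℕ) (h3 : 3 ≤ t) (htn : t ≤ n) : (pathJoinGraph n t).Connected := by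
  have hn : 0 < n := by omega
  have key : ∀ k (hk : k < n), k < t → (pathJoinGraph n t).Reachable ⟨0, hn⟩ ⟨k, hk⟩ := by
    intro k
    induction k with
    | zero => intro _ _; exact SimpleGraph.Reachable.refl _
    | succ k ih =>
      intro hk hkt
      refine (ih (by omega) (by omega)).trans (SimpleGraph.Adj.reachable ?_)
      refine (SimpleGraph.fromRel_adj _ _ _).2 ⟨?_, Or.inl (Or.inl ⟨rfl, hkt⟩)⟩
      intro e
      have := congrArg Fin.val e
      simp at this
  have all : ∀ v, (pathJoinGraph n t).Reachable ⟨0, hn⟩ v := by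
    intro v
    by_cases h : v.val < t
    · exact key v.val v.2 h
    · refine SimpleGraph.Adj.reachable ?_
      refine (SimpleGraph.fromRel_adj _ _ _).2 ⟨?_, Or.inl (Or.inr ⟨by simp; omega, by omega⟩)⟩
      intro e
      apply h
      rw [← e]
      simp; omega
  have : Nonempty (Fin n) := ⟨⟨0, hn⟩⟩
  exact ⟨fun u v => (all u).symm.trans (all v)⟩

end fw
end Reg16
theorem stmt16 (K : Type) [Field K] (n t : ℕ) (h3 : 3 ≤ t) (htn : t ≤ n) :
    ((pathJoinGraph n t).Connected ∧ idealReg (beIdeal K (pathJoinGraph n t)) = (t : ℤ)) ∧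
      ∃ G : SimpleGraph (Fin n), G.Connected ∧ idealReg (beIdeal K G) = (t : ℤ) := by
  have h := reg_eq (beIdeal K (pathJoinGraph n t)) (HI_be n t) t (upp n t h3 htn)
    (low n t h3 htn (HI_be n t))
  exact ⟨⟨conn n t h3 htn, h⟩, _, conn n t h3 htn, h⟩
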